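/- Let Δ be a graph (a 1-dimensional simplicial complex without isolated vertices). The following conditions are equivalent: (i) I_Δ^m is generalized Cohen–Macaulay for every m ≥ 1; (ii) I_Δ^m is generalized Cohen–Macaulay for some m ≥ 3; (iii) Δ is a union of disjoint paths and cycles. -/

import Mathlib

open CategoryTheory Opposite

/-! ### Abstract simplicial complexes -/

/-- An abstract simplicial complex on the vertex set `Fin n`: a collection of finite
subsets (faces) closed under taking subsets. -/
structure SimComplex (n : ℕ) where
  faces : Set (Finset (Fin n))
  down_closed : ∀ ⦃F G : Finset (Fin n)⦄, F ∈ faces → G ⊆ F → G ∈ faces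

namespace SimComplex

variable {n : ℕ}

/-- The vertex set of a simplicial complex. -/
def vertexSet (Δ : SimComplex n) : Set (Fin n) := {v | ({v} : Finset (Fin n)) ∈ Δ.faces}

/-- The dimension of a simplicial complex: the maximal cardinality of a face, minus one. -/
noncomputable def dim (Δ : SimComplex n) : ℤ :=
  (Int.ofNat (sSup (Finset.card '' Δ.faces))) - 1

/-- A facet is a maximal face. -/
def IsFacet (Δ : SimComplex n) (F : Finset (Fin n)) : Prop :=
  F ∈ Δ.faces ∧ ∀ G ∈ Δ.faces, F ⊆ G → F = G

/-- A complex is pure if all facets have the same cardinality. -/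
def Pure (Δ : SimComplex n) : Prop :=
  ∀ F G, Δ.IsFacet F → Δ.IsFacet G → F.card = G.card

/-- A matroid: for any two faces `F`, `G` with `|F| > |G|` there is `i ∈ F ∖ G`
with `G ∪ {i}` a face. -/
def IsMatroid (Δ : SimComplex n) : Prop :=
  ∀ F G, F ∈ Δ.faces → G ∈ Δ.faces → G.card < F.card →
    ∃ i ∈ F, i ∉ G ∧ insert i G ∈ Δ.faces

/-- The link of a face `G`: `{F ∖ G : G ⊆ F ∈ Δ}`. -/
def link (Δ : SimComplex n) (G : Finset (Fin n)) : SimComplex n where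
  faces := {F | Disjoint F G ∧ F ∪ G ∈ Δ.faces}
  down_closed := by
    intro F F' hF hsub
    exact ⟨hF.1.mono_left hsub, Δ.down_closed hF.2 (Finset.union_subset_union hsub subset_rfl)⟩

/-- The star of a face `G`: `{F ∈ Δ : F ∪ G ∈ Δ}`. -/
def star (Δ : SimComplex n) (G : Finset (Fin n)) : SimComplex n where
  faces := {F | F ∈ Δ.faces ∧ F ∪ G ∈ Δ.faces}
  down_closed := by
    intro F F' hF hsub
    exact ⟨Δ.down_closed hF.1 hsub, Δ.down_closed hF.2 (Finset.union_subset_union hsub subset_rfl)⟩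

/-- `Δ` is locally a matroid if the link of every vertex is a matroid. -/
def LocallyMatroid (Δ : SimComplex n) : Prop :=
  ∀ v ∈ Δ.vertexSet, (Δ.link {v}).IsMatroid

/-- Two vertices are adjacent if they span a 1-dimensional face (an edge). -/
def Adj (Δ : SimComplex n) (u v : Fin n) : Prop :=
  u ≠ v ∧ ({u, v} : Finset (Fin n)) ∈ Δ.faces

/-- Two vertices are joined by a path of edges. -/
def Reach (Δ : SimComplex n) : Fin n → Fin n → Prop := Relation.ReflTransGen Δ.Adj

/-- A complex is connected if any two vertices are joined by a path of edges. -/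
def Connected (Δ : SimComplex n) : Prop :=
  ∀ u ∈ Δ.vertexSet, ∀ v ∈ Δ.vertexSet, Δ.Reach u v

/-- The induced subcomplex on a set `W` of vertices. -/
def induced (Δ : SimComplex n) (W : Set (Fin n)) : SimComplex n where
  faces := {F | F ∈ Δ.faces ∧ ↑F ⊆ W}
  down_closed := by
    intro F F' hF hsub
    exact ⟨Δ.down_closed hF.1 hsub, subset_trans (Finset.coe_subset.2 hsub) hF.2⟩

/-- The connected component of a vertex `v`, as an induced subcomplex. -/
def component (Δ : SimComplex n) (v : Fin n) : SimComplex n :=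
  Δ.induced {u | Δ.Reach v u}

/-- A minimal nonface: a subset of the vertex set which is not a face, all of whose
proper subsets are faces. -/
def IsMinNonface (Δ : SimComplex n) (F : Finset (Fin n)) : Prop :=
  ↑F ⊆ Δ.vertexSet ∧ F ∉ Δ.faces ∧ ∀ G ⊂ F, G ∈ Δ.faces

/-- A complete intersection complex: the minimal nonfaces are pairwise disjoint. -/
def IsCompleteIntersection (Δ : SimComplex n) : Prop :=
  ∀ F G, Δ.IsMinNonface F → Δ.IsMinNonface G → F ≠ G → Disjoint F G

/-- `Δ` is locally a complete intersection if the link of every vertex is one. -/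
def LocallyCompleteIntersection (Δ : SimComplex n) : Prop :=
  ∀ v ∈ Δ.vertexSet, (Δ.link {v}).IsCompleteIntersection

/-- A path graph: vertices `f 0, …, f (k+1)` and edges exactly the consecutive pairs. -/
def IsPathGraph (Δ : SimComplex n) : Prop :=
  ∃ (k : ℕ) (f : Fin (k + 2) → Fin n), Function.Injective f ∧
    Δ.vertexSet = Set.range f ∧
    ∀ e : Finset (Fin n), (e ∈ Δ.faces ∧ e.card = 2) ↔
      ∃ i : Fin (k + 1), e = {f i.castSucc, f i.succ}

/-- A cycle graph: vertices `f 0, …, f (k+2)` and edges exactly the cyclically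
consecutive pairs. -/
def IsCycleGraph (Δ : SimComplex n) : Prop :=
  ∃ (k : ℕ) (f : Fin (k + 3) → Fin n), Function.Injective f ∧
    Δ.vertexSet = Set.range f ∧
    ∀ e : Finset (Fin n), (e ∈ Δ.faces ∧ e.card = 2) ↔
      ∃ i : Fin (k + 3), e = {f i, f (i + 1)}

end SimComplex

/-! ### Commutative-algebra notions -/

noncomputable section

/-- The `i`-th Ext group of two modules over a commutative ring. -/
def ExtGroup (A : Type) [CommRing A] (i : ℕ) (M N : Type) [AddCommGroup M] [Module A M]
    [AddCommGroup N] [Module A N] : Type :=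
  ((Ext A (ModuleCat A) i).obj (op (ModuleCat.of A M))).obj (ModuleCat.of A N)

/-- A local ring is Cohen–Macaulay if its depth equals its Krull dimension, i.e. if
`Ext^i(residue field, B)` vanishes for all `i < dim B`. -/
def IsCohenMacaulayLocalRing (B : Type) [CommRing B] [IsLocalRing B] : Prop :=
  ∀ i : ℕ, (i : WithBot ℕ∞) < ringKrullDim B →
    Subsingleton (ExtGroup B i (B ⧸ IsLocalRing.maximalIdeal B) B)

/-- A commutative ring is Cohen–Macaulay if all its localizations at primes are
Cohen–Macaulay local rings. -/
def IsCohenMacaulayRing (A : Type) [CommRing A] : Prop :=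
  ∀ (P : Ideal A) (hP : P.IsPrime),
    letI : P.IsPrime := hP
    IsCohenMacaulayLocalRing (Localization.AtPrime P)

/-- An ideal `I` of `A` is Cohen–Macaulay if `A ⧸ I` is a Cohen–Macaulay ring. -/
def IsCohenMacaulayIdeal {A : Type} [CommRing A] (I : Ideal A) : Prop :=
  IsCohenMacaulayRing (A ⧸ I)

/-- The ideal `I` satisfies Serre's condition `(S₂)`: for every prime `P` of `A`, the
depth of the localized module `(A⧸I)_P` over `A_P` is at least `min {2, height P}`,
where the height of `P` is the Krull dimension of `A_P` and depth is detected by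
vanishing of `Ext^i` from the residue field. -/
def SatisfiesS2 {A : Type} [CommRing A] (I : Ideal A) : Prop :=
  ∀ (P : Ideal A) (hP : P.IsPrime),
    letI : P.IsPrime := hP
    ∀ i : ℕ, (i : WithBot ℕ∞) < min 2 (ringKrullDim (Localization.AtPrime P)) →
      Subsingleton (ExtGroup (Localization.AtPrime P) i
        (Localization.AtPrime P ⧸ IsLocalRing.maximalIdeal (Localization.AtPrime P))
        (LocalizedModule P.primeCompl (A ⧸ I)))

/-- The `m`-th symbolic power of an ideal: the intersection of the `m`-th powers of
its minimal primes. -/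
def symbPowIdeal {A : Type} [CommRing A] (I : Ideal A) (m : ℕ) : Ideal A :=
  ⨅ P ∈ I.minimalPrimes, P ^ m

end

/-! ### Stanley–Reisner theory -/

noncomputable section

open MvPolynomial

/-- The squarefree monomial attached to a finite set of variables. -/
def faceMonomial (K : Type) [Field K] {n : ℕ} (F : Finset (Fin n)) : MvPolynomial (Fin n) K :=
  ∏ i ∈ F, X i

/-- The Stanley–Reisner ideal of a complex on `[n]`: generated by the squarefree
monomials corresponding to nonfaces. -/
def SRIdeal (K : Type) [Field K] {n : ℕ} (Δ : SimComplex n) : Ideal (MvPolynomial (Fin n) K) :=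
  Ideal.span {p | ∃ F : Finset (Fin n), F ∉ Δ.faces ∧ p = faceMonomial K F}

/-- The Stanley–Reisner ideal of a complex whose vertex set may be a proper subset of
`[n]`: generated by the squarefree monomials of nonfaces contained in the vertex set. -/
def SRIdealOn (K : Type) [Field K] {n : ℕ} (Δ : SimComplex n) : Ideal (MvPolynomial (Fin n) K) :=
  Ideal.span {p | ∃ F : Finset (Fin n), ↑F ⊆ Δ.vertexSet ∧ F ∉ Δ.faces ∧ p = faceMonomial K F}

/-- The prime ideal generated by the variables indexed by `F`. -/
def PF (K : Type) [Field K] {n : ℕ} (F : Finset (Fin n)) : Ideal (MvPolynomial (Fin n) K) :=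
  Ideal.span ((fun i => (X i : MvPolynomial (Fin n) K)) '' ↑F)

/-- The `m`-th symbolic power of the Stanley–Reisner ideal:
`I_Δ^{(m)} = ⋂_{F facet} P_{complement of F}^m`. -/
def SRSymbPow (K : Type) [Field K] {n : ℕ} (Δ : SimComplex n) (m : ℕ) :
    Ideal (MvPolynomial (Fin n) K) :=
  ⨅ (F : Finset (Fin n)) (_ : Δ.IsFacet F), (PF K Fᶜ) ^ m

/-- The cover ideal `J(Δ) = ⋂_{F facet} P_F` and its symbolic powers. -/
def coverSymbPow (K : Type) [Field K] {n : ℕ} (Δ : SimComplex n) (m : ℕ) :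
    Ideal (MvPolynomial (Fin n) K) :=
  ⨅ (F : Finset (Fin n)) (_ : Δ.IsFacet F), (PF K F) ^ m

/-- The graded maximal ideal `(x_1, …, x_n)`. -/
def maxIdeal (K : Type) [Field K] (n : ℕ) : Ideal (MvPolynomial (Fin n) K) :=
  Ideal.span (Set.range X)

/-- The `i`-th local cohomology module of `S ⧸ I` with support in the maximal
graded ideal. -/
def locCoh (K : Type) [Field K] {n : ℕ} (i : ℕ) (I : Ideal (MvPolynomial (Fin n) K)) :
    ModuleCat (MvPolynomial (Fin n) K) :=
  (localCohomology (maxIdeal K n) i).obj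
    (ModuleCat.of (MvPolynomial (Fin n) K) (MvPolynomial (Fin n) K ⧸ I))

/-- `I` is quasi-Buchsbaum: the maximal ideal annihilates all local cohomology modules
`H^i_m(S⧸I)` for `i < dim S⧸I`. -/
def IsQuasiBuchsbaum (K : Type) [Field K] {n : ℕ} (I : Ideal (MvPolynomial (Fin n) K)) : Prop :=
  ∀ i : ℕ, (i : WithBot ℕ∞) < ringKrullDim (MvPolynomial (Fin n) K ⧸ I) →
    ∀ x ∈ maxIdeal K n, ∀ y : (locCoh K i I), x • y = 0

/-- `I` is Buchsbaum: for `i < dim S⧸I` the natural map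
`Ext^i_S(S⧸m, S⧸I) → H^i_m(S⧸I)` (the structure map into the direct limit defining local
cohomology) is surjective. -/
def IsBuchsbaum (K : Type) [Field K] {n : ℕ} (I : Ideal (MvPolynomial (Fin n) K)) : Prop :=
  ∀ i : ℕ, (i : WithBot ℕ∞) < ringKrullDim (MvPolynomial (Fin n) K ⧸ I) →
    letI := localCohomology.hasColimitDiagram
      (localCohomology.idealPowersDiagram (maxIdeal K n)) i
    Function.Surjective
      ((CategoryTheory.Limits.colimit.ι
          (localCohomology.diagram (localCohomology.idealPowersDiagram (maxIdeal K n)) i)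
          (Opposite.op (Opposite.op (1 : ℕ)))).app
        (ModuleCat.of (MvPolynomial (Fin n) K) (MvPolynomial (Fin n) K ⧸ I)))

/-- `I` is generalized Cohen–Macaulay: the local cohomology modules `H^i_m(S⧸I)` are
finite-dimensional over `K` for `i < dim S⧸I`. -/
def IsGeneralizedCM (K : Type) [Field K] {n : ℕ} (I : Ideal (MvPolynomial (Fin n) K)) : Prop :=
  ∀ i : ℕ, (i : WithBot ℕ∞) < ringKrullDim (MvPolynomial (Fin n) K ⧸ I) →
    Module.Finite K (RestrictScalars K (MvPolynomial (Fin n) K) (locCoh K i I))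

end

/-! ### Monomial ideals -/

/-- A monomial ideal of `K[x_1,…,x_n]`. -/
def IsMonomialIdeal {K : Type} [Field K] {n : ℕ} (I : Ideal (MvPolynomial (Fin n) K)) : Prop :=
  ∃ S : Set (Fin n →₀ ℕ),
    I = Ideal.span {p | ∃ d ∈ S, p = MvPolynomial.monomial d (1 : K)}

/-- A squarefree monomial ideal of `K[x_1,…,x_n]`. -/
def IsSquarefreeMonomialIdeal {K : Type} [Field K] {n : ℕ}
    (I : Ideal (MvPolynomial (Fin n) K)) : Prop :=
  ∃ S : Set (Finset (Fin n)),
    I = Ideal.span {p | ∃ F ∈ S, p = ∏ i ∈ F, (MvPolynomial.X i : MvPolynomial (Fin n) K)}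

noncomputable section
open CategoryTheory Opposite Limits
namespace LCx
variable {R : Type} [CommRing R]

abbrev Zc (K : ChainComplex (ModuleCat.{0} R)ᵒᵖ ℕ) (n : ℕ) : Submodule R (K.X n).unop :=
  LinearMap.ker (K.d (n+1) n).unop.hom

def clsZ (K : ChainComplex (ModuleCat.{0} R)ᵒᵖ ℕ) (n : ℕ) :
    K.opcycles n ⟶ op (ModuleCat.of R (Zc K n)) :=
  K.descOpcycles (ModuleCat.ofHom (Zc K n).subtype).op (n+1) (by simp) (by
    apply Quiver.Hom.unop_inj
    ext x
    exact x.2)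

def clsK (K : ChainComplex (ModuleCat.{0} R)ᵒᵖ ℕ) (n : ℕ) :
    Zc K n →ₗ[R] (K.homology n).unop :=
  (K.homologyι n ≫ clsZ K n).unop.hom

lemma clsZ_spec (K : ChainComplex (ModuleCat.{0} R)ᵒᵖ ℕ) (n : ℕ) (c : Zc K n) :
    (K.pOpcycles n).unop.hom ((clsZ K n).unop.hom c) = c.1 := by
  have : (K.pOpcycles n) ≫ clsZ K n = (ModuleCat.ofHom (Zc K n).subtype).op := by
    simp [clsZ]
  have h2 := congrArg (fun f => f.unop.hom c) this
  exact h2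

lemma pOp_inj (K : ChainComplex (ModuleCat.{0} R)ᵒᵖ ℕ) (n : ℕ) :
    Function.Injective (K.pOpcycles n).unop.hom := by
  have : Mono (K.pOpcycles n).unop := inferInstance
  exact (ModuleCat.mono_iff_injective _).1 this

lemma clsZ_surj (K : ChainComplex (ModuleCat.{0} R)ᵒᵖ ℕ) (n : ℕ)  (o : (K.opcycles n).unop) :
    ∃ c : Zc K n, (clsZ K n).unop.hom c = o := by
  refine ⟨⟨(K.pOpcycles n).unop.hom o, ?_⟩, ?_⟩
  · have : K.d (n+1) n ≫ K.pOpcycles n = 0 := by simp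
    have h2 := congrArg (fun f => f.unop.hom o) this
    exact h2
  · apply pOp_inj
    rw [clsZ_spec]

lemma clsK_surj (K : ChainComplex (ModuleCat.{0} R)ᵒᵖ ℕ) (n : ℕ) :
    Function.Surjective (clsK K n) := by
  intro h
  have : Epi (K.homologyι n).unop := inferInstance
  obtain ⟨o, ho⟩ := (ModuleCat.epi_iff_surjective _).1 this h
  obtain ⟨c, hc⟩ := clsZ_surj K n o
  refine ⟨c, ?_⟩
  rw [← ho, ← hc]; rfl

lemma clsK_eq_zero_iff (K : ChainComplex (ModuleCat.{0} R)ᵒᵖ ℕ) (n : ℕ) (c : Zc K (n+1)) :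
    clsK K (n+1) c = 0 ↔ ∃ g : (K.X n).unop, (K.d (n+1) n).unop.hom g = c.1 := by
  have hex : (ShortComplex.mk (K.homologyι (n+1)) (K.fromOpcycles (n+1) n) (by simp)).Exact :=
    ShortComplex.exact_of_f_is_kernel _ (K.homologyIsKernel (n+1) n (by simp))
  have hex2 := hex.unop
  rw [ShortComplex.moduleCat_exact_iff] at hex2
  have hp : ∀ g, (K.pOpcycles (n+1)).unop.hom ((K.fromOpcycles (n+1) n).unop.hom g)
      = (K.d (n+1) n).unop.hom g := by
    intro g
    have : (K.pOpcycles (n+1)) ≫ K.fromOpcycles (n+1) n = K.d (n+1) n := by simp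
    exact congrArg (fun f => f.unop.hom g) this
  constructor
  · intro h
    obtain ⟨g, hg⟩ := hex2 ((clsZ K (n+1)).unop.hom c) h
    exact ⟨g, (hp g).symm.trans (Eq.trans
      (congrArg (K.pOpcycles (n+1)).unop.hom hg) (clsZ_spec K (n+1) c))⟩
  · rintro ⟨g, hg⟩
    have h1 : (clsZ K (n+1)).unop.hom c = (K.fromOpcycles (n+1) n).unop.hom g := by
      apply pOp_inj
      rw [clsZ_spec, hp, hg]
    have h2 : K.homologyι (n+1) ≫ K.fromOpcycles (n+1) n = 0 := by simp
    have h3 := congrArg (fun f => f.unop.hom g) h2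
    have h4 : clsK K (n+1) c = (K.homologyι (n+1)).unop.hom ((clsZ K (n+1)).unop.hom c) := rfl
    rw [h4, h1]
    exact h3

lemma clsK_zero_eq_zero (K : ChainComplex (ModuleCat.{0} R)ᵒᵖ ℕ) (c : Zc K 0)
    (h : clsK K 0 c = 0) : c = 0 := by
  have : Mono (K.homologyι 0).unop := by
    have : IsIso (K.homologyι 0) := K.isIso_homologyι 0 _ rfl (by simp)
    infer_instance
  have h1 := (ModuleCat.mono_iff_injective _).1 this
  have h2 : (clsZ K 0).unop.hom c = 0 := h1 (by rw [map_zero]; exact h)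
  have := clsZ_spec K 0 c
  rw [h2, map_zero] at this
  exact Subtype.ext this.symm

lemma clsK_map {K L : ChainComplex (ModuleCat.{0} R)ᵒᵖ ℕ} (f : K ⟶ L) (n : ℕ) (c : Zc L n)
    (c' : Zc K n) (hc : (f.f n).unop.hom c.1 = c'.1) :
    (HomologicalComplex.homologyMap f n).unop.hom (clsK L n c) = clsK K n c' := by
  have h1 : HomologicalComplex.homologyMap f n ≫ L.homologyι n =
    K.homologyι n ≫ HomologicalComplex.opcyclesMap f n := by simp
  have h2 := congrArg (fun g => g.unop.hom ((clsZ L n).unop.hom c)) h1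
  have h3 : (HomologicalComplex.opcyclesMap f n).unop.hom ((clsZ L n).unop.hom c) =
      (clsZ K n).unop.hom c' := by
    apply pOp_inj
    rw [clsZ_spec, ← hc]
    have h4 : K.pOpcycles n ≫ HomologicalComplex.opcyclesMap f n = f.f n ≫ L.pOpcycles n := by simp
    have h5 := congrArg (fun g => g.unop.hom ((clsZ L n).unop.hom c)) h4
    refine Eq.trans h5 ?_
    exact congrArg _ (clsZ_spec L n c)
  refine Eq.trans h2 ?_
  exact congrArg (K.homologyι n).unop.hom h3
end LCx

end

noncomputable section
open CategoryTheory Opposite Limits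
namespace LCx
variable {R : Type} [CommRing R]

abbrev FY (M : ModuleCat.{0} R) : ModuleCat.{0} R ⥤ (ModuleCat.{0} R)ᵒᵖ :=
  ((linearYoneda R (ModuleCat.{0} R)).obj M).rightOp

abbrev KY {X : ModuleCat.{0} R} (P : ProjectiveResolution X) (M : ModuleCat.{0} R) :
    ChainComplex (ModuleCat.{0} R)ᵒᵖ ℕ := ((FY M).mapHomologicalComplex _).obj P.complex

lemma KY_d {X : ModuleCat.{0} R} (P : ProjectiveResolution X) (M : ModuleCat.{0} R) (i j : ℕ)
    (c : P.complex.X j ⟶ M) :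
    ((KY P M).d i j).unop.hom c = P.complex.d i j ≫ c := rfl

abbrev ExtO (n : ℕ) (X M : ModuleCat.{0} R) : ModuleCat.{0} R :=
  ((Ext R (ModuleCat.{0} R) n).obj (op X)).obj M

def isoE {X : ModuleCat.{0} R} (P : ProjectiveResolution X) (n : ℕ) (M : ModuleCat.{0} R) :
    ((KY P M).homology n).unop ≅ ExtO n X M :=
  (P.isoLeftDerivedObj (FY M) n).unop

def clsE {X : ModuleCat.{0} R} (P : ProjectiveResolution X) (n : ℕ) (M : ModuleCat.{0} R) :
    Zc (KY P M) n →ₗ[R] ExtO n X M :=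
  (isoE P n M).hom.hom ∘ₗ clsK (KY P M) n

lemma clsE_surj {X : ModuleCat.{0} R} (P : ProjectiveResolution X) (n : ℕ) (M : ModuleCat.{0} R) :
    Function.Surjective (clsE P n M) := by
  intro y
  obtain ⟨c, hc⟩ := clsK_surj (KY P M) n ((isoE P n M).inv.hom y)
  refine ⟨c, ?_⟩
  change (isoE P n M).hom.hom (clsK (KY P M) n c) = y
  rw [hc]
  exact congrArg (fun f => f.hom y) (isoE P n M).inv_hom_id

lemma clsE_eq_zero_iff {X : ModuleCat.{0} R} (P : ProjectiveResolution X) (n : ℕ)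
    (M : ModuleCat.{0} R) (c : Zc (KY P M) n) :
    clsE P n M c = 0 ↔ clsK (KY P M) n c = 0 := by
  constructor
  · intro h
    have h2 := congrArg (fun f => f.hom (clsK (KY P M) n c)) (isoE P n M).hom_inv_id
    change (isoE P n M).inv.hom (clsE P n M c) = _ at h2
    rw [h, map_zero] at h2
    exact h2.symm
  · intro h
    change (isoE P n M).hom.hom (clsK (KY P M) n c) = 0
    rw [h, map_zero]

lemma clsE_map {X X' : ModuleCat.{0} R} (P : ProjectiveResolution X) (P' : ProjectiveResolution X')
    (n : ℕ) (M : ModuleCat.{0} R) (f : X' ⟶ X) (φ : P'.complex ⟶ P.complex)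
    (comm : φ.f 0 ≫ P.π.f 0 = P'.π.f 0 ≫ f)
    (c : Zc (KY P M) n) (c' : Zc (KY P' M) n)
    (hc : (c'.1 : P'.complex.X n ⟶ M) = φ.f n ≫ (c.1 : P.complex.X n ⟶ M)) :
    (((Ext R (ModuleCat.{0} R) n).map f.op).app M).hom (clsE P n M c) = clsE P' n M c' := by
  have h := P'.isoLeftDerivedObj_hom_naturality f P φ comm (FY M) n
  have h1 := clsK_map (((FY M).mapHomologicalComplex _).map φ) n c c' hc.symm
  have h2 := congrArg (fun g => g.unop.hom (clsK (KY P M) n c)) h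
  refine Eq.trans h2 ?_
  exact congrArg (isoE P' n M).hom.hom h1

/-! ### concrete description -/

/-- cochain from a map of the ideal -/
structure Lift {J : Ideal R} (P : ProjectiveResolution (ModuleCat.of R (R ⧸ J))) where
  al : P.complex.X 0 →ₗ[R] R
  be : R →ₗ[R] P.complex.X 0
  hal : ∀ x, Ideal.Quotient.mk J (al x) = (P.π.f 0).hom x
  hbe : ∀ x, (P.π.f 0).hom (be x) = Ideal.Quotient.mk J x

lemma pi_surj {X : ModuleCat.{0} R} (P : ProjectiveResolution X) :
    Function.Surjective (P.π.f 0).hom := by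
  have : Epi (P.π.f 0) := inferInstance
  exact (ModuleCat.epi_iff_surjective _).1 this

lemma pi_ker {X : ModuleCat.{0} R} (P : ProjectiveResolution X) (x : P.complex.X 0)
    (hx : (P.π.f 0).hom x = 0) : ∃ y, (P.complex.d 1 0).hom y = x := by
  have := P.exact₀
  rw [ShortComplex.moduleCat_exact_iff] at this
  exact this x hx

lemma pi_d {X : ModuleCat.{0} R} (P : ProjectiveResolution X) (y : P.complex.X 1) :
    (P.π.f 0).hom ((P.complex.d 1 0).hom y) = 0 := by
  have := P.complex_d_comp_π_f_zero
  exact congrArg (fun f => f.hom y) this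

lemma d_d {X : ModuleCat.{0} R} (P : ProjectiveResolution X) (y : P.complex.X 2) :
    (P.complex.d 1 0).hom ((P.complex.d 2 1).hom y) = 0 := by
  have := P.complex.d_comp_d 2 1 0
  exact congrArg (fun f => f.hom y) this

lemma d_exact {X : ModuleCat.{0} R} (P : ProjectiveResolution X) (x : P.complex.X 1)
    (hx : (P.complex.d 1 0).hom x = 0) : ∃ y, (P.complex.d 2 1).hom y = x := by
  have := P.exact_succ 0
  rw [ShortComplex.moduleCat_exact_iff] at this
  exact this x hx

lemma exists_lift {J : Ideal R} (P : ProjectiveResolution (ModuleCat.of R (R ⧸ J))) :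
    Nonempty (Lift P) := by
  have : Projective (P.complex.X 0) := P.projective 0
  have : Module.Projective R (P.complex.X 0) :=
    (IsProjective.iff_projective (P.complex.X 0)).2 this
  obtain ⟨al, hal⟩ := Module.projective_lifting_property (J.mkQ) (P.π.f 0).hom
    (Submodule.mkQ_surjective _)
  obtain ⟨be, hbe⟩ := Module.projective_lifting_property (P.π.f 0).hom (J.mkQ)
    (pi_surj P)
  exact ⟨⟨al, be, fun x => LinearMap.congr_fun hal x, fun x => LinearMap.congr_fun hbe x⟩⟩

end LCx

end

noncomputable section
open CategoryTheory Opposite Limits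
namespace LCx
variable {R : Type} [CommRing R]

abbrev QJ (J : Ideal R) : ModuleCat.{0} R := ModuleCat.of R (R ⧸ J)
abbrev PJ (J : Ideal R) : ProjectiveResolution (QJ J) := ProjectiveResolution.of (QJ J)
def LJ (J : Ideal R) : Lift (PJ J) := (exists_lift (PJ J)).some

lemma al_mem (J : Ideal R) (x : (PJ J).complex.X 0) (hx : ((PJ J).π.f 0).hom x = 0) :
    (LJ J).al x ∈ J := by
  have := (LJ J).hal x
  rw [hx] at this
  exact Ideal.Quotient.eq_zero_iff_mem.1 this

def alJ (J : Ideal R) : (PJ J).complex.X 1 →ₗ[R] J :=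
  LinearMap.codRestrict J ((LJ J).al ∘ₗ ((PJ J).complex.d 1 0).hom)
    (fun y => al_mem J _ (pi_d _ y))

def mkZ {X : ModuleCat.{0} R} (P : ProjectiveResolution X) (M : ModuleCat.{0} R) (n : ℕ)
    (c : P.complex.X n →ₗ[R] M) (hc : ∀ y, c ((P.complex.d (n+1) n).hom y) = 0) :
    Zc (KY P M) n :=
  ⟨(ModuleCat.ofHom c : P.complex.X n ⟶ M),
    ModuleCat.hom_ext (M := P.complex.X (n+1)) (N := M) (LinearMap.ext hc)⟩

def toL {X : ModuleCat.{0} R} (P : ProjectiveResolution X) (M : ModuleCat.{0} R) (n : ℕ)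
    (c : Zc (KY P M) n) : P.complex.X n →ₗ[R] M :=
  ModuleCat.Hom.hom (show P.complex.X n ⟶ M from c.1)

lemma toL_d {X : ModuleCat.{0} R} (P : ProjectiveResolution X) (M : ModuleCat.{0} R) (n : ℕ)
    (c : Zc (KY P M) n) (y) : toL P M n c ((P.complex.d (n+1) n).hom y) = 0 :=
  congrArg (fun f : P.complex.X (n+1) ⟶ M => f.hom y) c.2

lemma toL_ext {X : ModuleCat.{0} R} (P : ProjectiveResolution X) (M : ModuleCat.{0} R) (n : ℕ)
    (c c' : Zc (KY P M) n) (h : ∀ y, toL P M n c y = toL P M n c' y) : c = c' :=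
  Subtype.ext (ModuleCat.hom_ext (M := P.complex.X n) (N := M) (LinearMap.ext h))

lemma cls1_zero {X : ModuleCat.{0} R} (P : ProjectiveResolution X) (M : ModuleCat.{0} R)
    (c : Zc (KY P M) 1) : clsE P 1 M c = 0 ↔
      ∃ g : P.complex.X 0 →ₗ[R] M, ∀ y, g ((P.complex.d 1 0).hom y) = toL P M 1 c y := by
  rw [clsE_eq_zero_iff, clsK_eq_zero_iff]
  constructor
  · rintro ⟨g, hg⟩
    exact ⟨ModuleCat.Hom.hom (show P.complex.X 0 ⟶ M from g), fun y =>
      congrArg (fun f : P.complex.X 1 ⟶ M => f.hom y) hg⟩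
  · rintro ⟨g, hg⟩
    exact ⟨(ModuleCat.ofHom g : P.complex.X 0 ⟶ M),
      ModuleCat.hom_ext (M := P.complex.X 1) (N := M) (LinearMap.ext hg)⟩

/-- cochain of `ψ` -/
def z1 (J : Ideal R) (M : ModuleCat.{0} R) : (J →ₗ[R] M) →ₗ[R] Zc (KY (PJ J) M) 1 where
  toFun ψ := mkZ (PJ J) M 1 (ψ ∘ₗ alJ J) (fun y => by
    have : alJ J (((PJ J).complex.d 2 1).hom y) = 0 := by
      apply Subtype.ext
      change (LJ J).al (((PJ J).complex.d 1 0).hom _) = 0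
      rw [d_d, map_zero]
    change ψ (alJ J (((PJ J).complex.d 2 1).hom y)) = 0
    rw [this, map_zero])
  map_add' ψ φ := by
    apply Subtype.ext
    rfl
  map_smul' r ψ := by
    apply Subtype.ext
    rfl

def e1 (J : Ideal R) (M : ModuleCat.{0} R) : (J →ₗ[R] M) →ₗ[R] ExtO 1 (QJ J) M :=
  clsE (PJ J) 1 M ∘ₗ z1 J M

lemma e1_surj (J : Ideal R) (M : ModuleCat.{0} R) : Function.Surjective (e1 J M) := by
  intro y
  obtain ⟨c, rfl⟩ := clsE_surj (PJ J) 1 M y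
  let c0 := toL (PJ J) M 1 c
  have hc0 : ∀ y, c0 (((PJ J).complex.d 2 1).hom y) = 0 := toL_d _ _ _ c
  have hc1 : ∀ x, ((PJ J).complex.d 1 0).hom x = 0 → c0 x = 0 := by
    intro x hx
    obtain ⟨y, rfl⟩ := d_exact _ x hx
    exact hc0 y
  -- c̄ on the kernel
  let Z : Submodule R ((PJ J).complex.X 0) := LinearMap.ker ((PJ J).π.f 0).hom
  choose s hs using fun x : Z => pi_ker (PJ J) x.1 x.2
  have huniq : ∀ (x y : (PJ J).complex.X 1),
    ((PJ J).complex.d 1 0).hom x = ((PJ J).complex.d 1 0).hom y → c0 x = c0 y := by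
    intro x y h
    rw [← sub_eq_zero, ← map_sub]
    apply hc1
    rw [map_sub, h, sub_self]
  let cb : Z →ₗ[R] M :=
    { toFun := fun x => c0 (s x)
      map_add' := fun x y => by
        rw [← map_add]; apply huniq; simp [hs]
      map_smul' := fun r x => by
        rw [RingHom.id_apply, ← map_smul]; apply huniq; simp [hs] }
  have hcb : ∀ y (hy : ((PJ J).complex.d 1 0).hom y ∈ Z), cb ⟨_, hy⟩ = c0 y := by
    intro y hy
    apply huniq
    rw [hs]
  have hbZ : ∀ p : J, (LJ J).be p.1 ∈ Z := by
    intro p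
    rw [LinearMap.mem_ker, (LJ J).hbe]
    exact Ideal.Quotient.eq_zero_iff_mem.2 p.2
  let ψ : J →ₗ[R] M := cb ∘ₗ LinearMap.codRestrict Z ((LJ J).be ∘ₗ J.subtype) hbZ
  have hdZ : ∀ x, (LJ J).be ((LJ J).al x) - x ∈ Z := by
    intro x
    rw [LinearMap.mem_ker, map_sub, (LJ J).hbe, (LJ J).hal, sub_self]
  let g : (PJ J).complex.X 0 →ₗ[R] M :=
    cb ∘ₗ LinearMap.codRestrict Z ((LJ J).be ∘ₗ (LJ J).al - LinearMap.id) hdZ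
  refine ⟨ψ, ?_⟩
  rw [← sub_eq_zero]
  change clsE (PJ J) 1 M (z1 J M ψ) - _ = 0
  rw [← map_sub, cls1_zero]
  refine ⟨g, fun y => ?_⟩
  change g (((PJ J).complex.d 1 0).hom y) = ψ (alJ J y) - c0 y
  rw [← hcb y (pi_d _ y)]
  change cb _ = cb _ - cb _
  rw [← map_sub]
  congr 1

lemma e1_eq_zero_iff (J : Ideal R) (M : ModuleCat.{0} R) (ψ : J →ₗ[R] M) :
    e1 J M ψ = 0 ↔ ∃ w : M, ∀ p : J, ψ p = p.1 • w := by
  change clsE (PJ J) 1 M (z1 J M ψ) = 0 ↔ _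
  rw [cls1_zero]
  constructor
  · rintro ⟨g0, hg0⟩
    replace hg0 : ∀ y, g0 (((PJ J).complex.d 1 0).hom y) = ψ (alJ J y) := hg0
    have hj : (LJ J).al ((LJ J).be 1) - 1 ∈ J := by
      rw [← Ideal.Quotient.mk_eq_mk_iff_sub_mem, (LJ J).hal, (LJ J).hbe]
    refine ⟨g0 ((LJ J).be 1) - ψ ⟨_, hj⟩, fun p => ?_⟩
    obtain ⟨y, hy⟩ := pi_ker (PJ J) ((LJ J).be p.1) (by
      rw [(LJ J).hbe]; exact Ideal.Quotient.eq_zero_iff_mem.2 p.2)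
    have h1 := hg0 y
    rw [hy] at h1
    rw [smul_sub, ← map_smul, ← map_smul, ← map_smul]
    have h2 : (p.1 • (1:R)) = p.1 := by simp
    rw [h2, h1, ← map_sub]
    congr 1
    apply Subtype.ext
    have h3 : (LJ J).al ((LJ J).be p.1) = p.1 * (LJ J).al ((LJ J).be 1) := by
      conv_lhs => rw [← h2, map_smul, map_smul]
      rfl
    simp [alJ, hy, h3]
    ring
  · rintro ⟨w, hw⟩
    refine ⟨(LinearMap.toSpanSingleton R M w) ∘ₗ (LJ J).al, fun y => ?_⟩
    exact (hw (alJ J y)).symm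

def qmap {J' J : Ideal R} (h : J' ≤ J) : QJ J' ⟶ QJ J :=
  ModuleCat.ofHom <| Submodule.mapQ _ _ LinearMap.id h

lemma e1_map {J' J : Ideal R} (h : J' ≤ J) (M : ModuleCat.{0} R) (ψ : J →ₗ[R] M) :
    (((Ext R (ModuleCat.{0} R) 1).map (qmap h).op).app M).hom (e1 J M ψ) =
      e1 J' M (ψ ∘ₗ Submodule.inclusion h) := by
  let φ := ProjectiveResolution.lift (qmap h) (PJ J') (PJ J)
  have comm : φ.f 0 ≫ (PJ J).π.f 0 = (PJ J').π.f 0 ≫ qmap h :=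
    ProjectiveResolution.lift_commutes_zero (qmap h) (PJ J') (PJ J)
  have hcomm : ∀ x, ((PJ J).π.f 0).hom ((φ.f 0).hom x) = (qmap h).hom (((PJ J').π.f 0).hom x) :=
    fun x => congrArg (fun f => f.hom x) comm
  have hd : ∀ y, ((PJ J).complex.d 1 0).hom ((φ.f 1).hom y) =
      (φ.f 0).hom (((PJ J').complex.d 1 0).hom y) := fun y =>
    congrArg (fun f => f.hom y) (φ.comm 1 0)
  have hq : ∀ a : R, (qmap h).hom (Ideal.Quotient.mk J' a) = Ideal.Quotient.mk J a :=
    fun a => rfl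
  have hdd : ∀ y, (φ.f 1).hom (((PJ J').complex.d 2 1).hom y) =
      ((PJ J).complex.d 2 1).hom ((φ.f 2).hom y) := fun y =>
    congrArg (fun f => f.hom y) (φ.comm 2 1).symm
  let c' : Zc (KY (PJ J') M) 1 := mkZ (PJ J') M 1 (toL (PJ J) M 1 (z1 J M ψ) ∘ₗ (φ.f 1).hom)
    (fun y => by
      change toL (PJ J) M 1 (z1 J M ψ) ((φ.f 1).hom (((PJ J').complex.d 2 1).hom y)) = 0
      rw [hdd]
      exact toL_d (PJ J) M 1 (z1 J M ψ) _)
  refine Eq.trans (clsE_map (PJ J) (PJ J') 1 M (qmap h) φ comm (z1 J M ψ) c' rfl) ?_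
  rw [← sub_eq_zero]
  change _ - clsE (PJ J') 1 M (z1 J' M _) = 0
  rw [← map_sub, cls1_zero]
  have hmem : ∀ x, ((LJ J).al ∘ₗ (φ.f 0).hom - (LJ J').al) x ∈ J := by
    intro x
    change (LJ J).al ((φ.f 0).hom x) - (LJ J').al x ∈ J
    rw [← Ideal.Quotient.mk_eq_mk_iff_sub_mem, (LJ J).hal, hcomm, ← (LJ J').hal, hq]
  refine ⟨ψ ∘ₗ LinearMap.codRestrict J _ hmem, fun y => ?_⟩
  change ψ _ = ψ (alJ J ((φ.f 1).hom y)) - ψ (Submodule.inclusion h (alJ J' y))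
  rw [← map_sub]
  congr 1
  apply Subtype.ext
  change (LJ J).al ((φ.f 0).hom _) - (LJ J').al _ = (LJ J).al (((PJ J).complex.d 1 0).hom _) - _
  rw [hd]
  rfl

def piL (J : Ideal R) : (PJ J).complex.X 0 →ₗ[R] (R ⧸ J) := ((PJ J).π.f 0).hom

def e0 (J : Ideal R) (M : ModuleCat.{0} R) : ((R ⧸ J) →ₗ[R] M) →ₗ[R] ExtO 0 (QJ J) M :=
  clsE (PJ J) 0 M ∘ₗ
  { toFun := fun φ => mkZ (PJ J) M 0 (φ ∘ₗ piL J) (fun y => by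
      change φ (((PJ J).π.f 0).hom (((PJ J).complex.d 1 0).hom y)) = 0
      rw [pi_d]
      exact map_zero φ)
    map_add' := fun _ _ => rfl
    map_smul' := fun _ _ => rfl }

lemma e0_surj (J : Ideal R) (M : ModuleCat.{0} R) : Function.Surjective (e0 J M) := by
  intro y
  obtain ⟨c, rfl⟩ := clsE_surj (PJ J) 0 M y
  let c0 := toL (PJ J) M 0 c
  have hc0 : ∀ y, c0 (((PJ J).complex.d 1 0).hom y) = 0 := toL_d _ _ _ c
  have huniq : ∀ x y, piL J x = piL J y → c0 x = c0 y := by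
    intro x y h
    obtain ⟨z, hz⟩ := pi_ker (PJ J) (x - y) (by change piL J _ = 0; rw [map_sub, h, sub_self])
    rw [← sub_eq_zero, ← map_sub, ← hz, hc0]
  choose s hs using (show Function.Surjective (piL J) from pi_surj (PJ J))
  let φ : (R ⧸ J) →ₗ[R] M :=
    { toFun := fun x => c0 (s x)
      map_add' := fun x y => by
        rw [← map_add]; apply huniq; rw [map_add, hs, hs, hs]
      map_smul' := fun r x => by
        rw [RingHom.id_apply, ← map_smul]; apply huniq; rw [map_smul, hs, hs] }
  refine ⟨φ, ?_⟩
  change clsE (PJ J) 0 M _ = _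
  congr 1
  refine toL_ext _ _ _ _ _ (fun x => ?_)
  change c0 (s (piL J x)) = c0 x
  apply huniq
  rw [hs]

lemma e0_map {J' J : Ideal R} (h : J' ≤ J) (M : ModuleCat.{0} R) (ψ : (R ⧸ J) →ₗ[R] M) :
    (((Ext R (ModuleCat.{0} R) 0).map (qmap h).op).app M).hom (e0 J M ψ) =
      e0 J' M (ψ ∘ₗ (Submodule.mapQ _ _ LinearMap.id h)) := by
  let φ := ProjectiveResolution.lift (qmap h) (PJ J') (PJ J)
  have comm : φ.f 0 ≫ (PJ J).π.f 0 = (PJ J').π.f 0 ≫ qmap h :=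
    ProjectiveResolution.lift_commutes_zero (qmap h) (PJ J') (PJ J)
  refine clsE_map (PJ J) (PJ J') 0 M (qmap h) φ comm _ _ ?_
  refine ModuleCat.hom_ext (M := (PJ J').complex.X 0) (N := M) (LinearMap.ext fun x => ?_)
  exact congrArg ψ (congrArg (fun f => f.hom x) comm).symm
end LCx

end

noncomputable section
open CategoryTheory Opposite Limits
namespace LCx
variable {R : Type} [CommRing R]

def lcDiag (m : Ideal R) (i : ℕ) := localCohomology.diagram (localCohomology.idealPowersDiagram m) i

instance (m : Ideal R) (i : ℕ) : HasColimit (lcDiag m i) :=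
  localCohomology.hasColimitDiagram (localCohomology.idealPowersDiagram m) i

def lcCocone (m : Ideal R) (i : ℕ) (M : ModuleCat.{0} R) :=
  ((evaluation (ModuleCat.{0} R) (ModuleCat.{0} R)).obj M).mapCocone (colimit.cocone (lcDiag m i))

def lcIsColimit (m : Ideal R) (i : ℕ) (M : ModuleCat.{0} R) : IsColimit (lcCocone m i M) :=
  isColimitOfPreserves ((evaluation (ModuleCat.{0} R) (ModuleCat.{0} R)).obj M)
    (colimit.isColimit (lcDiag m i))

abbrev LC (m : Ideal R) (i : ℕ) (M : ModuleCat.{0} R) : ModuleCat.{0} R :=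
  (localCohomology m i).obj M

def lcι (m : Ideal R) (i : ℕ) (M : ModuleCat.{0} R) (t : ℕ) :
    ExtO i (QJ (m ^ t)) M →ₗ[R] LC m i M :=
  ((lcCocone m i M).ι.app (op (op t))).hom

def lcTr (m : Ideal R) (i : ℕ) (M : ModuleCat.{0} R) {t t' : ℕ} (h : t ≤ t') :
    ExtO i (QJ (m ^ t)) M →ₗ[R] ExtO i (QJ (m ^ t')) M :=
  (((Ext R (ModuleCat.{0} R) i).map (qmap (Ideal.pow_le_pow_right (I := m) h)).op).app M).hom

def homT {t t' : ℕ} (h : t ≤ t') : (op (op t) : ℕᵒᵖᵒᵖ) ⟶ op (op t') := (homOfLE h).op.op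

lemma lcTr_ι (m : Ideal R) (i : ℕ) (M : ModuleCat.{0} R) {t t' : ℕ} (h : t ≤ t') (x) :
    lcι m i M t' (lcTr m i M h x) = lcι m i M t x := by
  have := (lcCocone m i M).w (homT h)
  exact congrArg (fun f => f.hom x) this

lemma lcι_surj (m : Ideal R) (i : ℕ) (M : ModuleCat.{0} R) (y : LC m i M) :
    ∃ t x, lcι m i M t x = y := by
  obtain ⟨j, x, hx⟩ := Concrete.isColimit_exists_rep _ (lcIsColimit m i M) y
  exact ⟨j.unop.unop, x, hx⟩

lemma lcι_zero (m : Ideal R) (i : ℕ) (M : ModuleCat.{0} R) (t : ℕ) (x)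
    (hx : lcι m i M t x = 0) : ∃ (t' : ℕ) (h : t ≤ t'), lcTr m i M h x = 0 := by
  have h0 : lcι m i M t x = lcι m i M t 0 := by rw [hx, map_zero]
  obtain ⟨k, f, g, hfg⟩ := Concrete.isColimit_exists_of_rep_eq
    _ (lcIsColimit m i M) (i := op (op t)) (j := op (op t)) x 0 h0
  have ht : t ≤ k.unop.unop := leOfHom f.unop.unop
  refine ⟨k.unop.unop, ht, ?_⟩
  rw [map_zero] at hfg
  exact hfg

def q1 (m : Ideal R) (M : ModuleCat.{0} R) (t : ℕ) : ((m ^ t : Ideal R) →ₗ[R] M) →ₗ[R] LC m 1 M :=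
  lcι m 1 M t ∘ₗ e1 (m ^ t) M

def q0 (m : Ideal R) (M : ModuleCat.{0} R) (t : ℕ) : ((R ⧸ m ^ t) →ₗ[R] M) →ₗ[R] LC m 0 M :=
  lcι m 0 M t ∘ₗ e0 (m ^ t) M

def res1 (m : Ideal R) (M : ModuleCat.{0} R) {t t' : ℕ} (h : t ≤ t') :
    ((m ^ t : Ideal R) →ₗ[R] M) →ₗ[R] ((m ^ t' : Ideal R) →ₗ[R] M) :=
  LinearMap.lcomp R M (Submodule.inclusion (Ideal.pow_le_pow_right (I := m) h))

def res0 (m : Ideal R) (M : ModuleCat.{0} R) {t t' : ℕ} (h : t ≤ t') :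
    ((R ⧸ m ^ t) →ₗ[R] M) →ₗ[R] ((R ⧸ m ^ t') →ₗ[R] M) :=
  LinearMap.lcomp R M (Submodule.mapQ _ _ LinearMap.id (Ideal.pow_le_pow_right (I := m) h))

lemma q1_res (m : Ideal R) (M : ModuleCat.{0} R) {t t' : ℕ} (h : t ≤ t') (ψ) :
    q1 m M t' (res1 m M h ψ) = q1 m M t ψ := by
  have h1 := e1_map (Ideal.pow_le_pow_right (I := m) h) M ψ
  have h2 := lcTr_ι m 1 M h (e1 (m ^ t) M ψ)
  exact (congrArg (lcι m 1 M t') h1).symm.trans h2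

lemma q0_res (m : Ideal R) (M : ModuleCat.{0} R) {t t' : ℕ} (h : t ≤ t') (ψ) :
    q0 m M t' (res0 m M h ψ) = q0 m M t ψ := by
  have h1 := e0_map (Ideal.pow_le_pow_right (I := m) h) M ψ
  have h2 := lcTr_ι m 0 M h (e0 (m ^ t) M ψ)
  exact (congrArg (lcι m 0 M t') h1).symm.trans h2

lemma q1_surj (m : Ideal R) (M : ModuleCat.{0} R) (y : LC m 1 M) : ∃ t ψ, q1 m M t ψ = y := by
  obtain ⟨t, x, rfl⟩ := lcι_surj m 1 M y
  obtain ⟨ψ, rfl⟩ := e1_surj _ _ x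
  exact ⟨t, ψ, rfl⟩

lemma q0_surj (m : Ideal R) (M : ModuleCat.{0} R) (y : LC m 0 M) : ∃ t ψ, q0 m M t ψ = y := by
  obtain ⟨t, x, rfl⟩ := lcι_surj m 0 M y
  obtain ⟨ψ, rfl⟩ := e0_surj _ _ x
  exact ⟨t, ψ, rfl⟩

lemma q1_of_mul (m : Ideal R) (M : ModuleCat.{0} R) (t : ℕ) (ψ) (w : M)
    (hw : ∀ p : (m ^ t : Ideal R), ψ p = p.1 • w) : q1 m M t ψ = 0 := by
  have : e1 (m ^ t) M ψ = 0 := (e1_eq_zero_iff _ _ _).2 ⟨w, hw⟩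
  change lcι m 1 M t (e1 (m ^ t) M ψ) = 0
  rw [this, map_zero]

lemma q1_zero (m : Ideal R) (M : ModuleCat.{0} R) (t : ℕ) (ψ) (h : q1 m M t ψ = 0) :
    ∃ (t' : ℕ) (h : t ≤ t'), ∃ w : M, ∀ p : (m ^ t' : Ideal R), res1 m M h ψ p = p.1 • w := by
  obtain ⟨t', ht, hx⟩ := lcι_zero m 1 M t _ h
  refine ⟨t', ht, ?_⟩
  rw [← e1_eq_zero_iff]
  exact (e1_map (Ideal.pow_le_pow_right (I := m) ht) M ψ).symm.trans hx

/-- abstract finiteness -/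
lemma finite_of_directed [IsNoetherianRing R] {H V : Type} [AddCommGroup H] [Module R H]
    [AddCommGroup V] [Module R V] [Module.Finite R V]
    (A : ℕ → Type) [∀ t, AddCommGroup (A t)] [∀ t, Module R (A t)]
    (q : ∀ t, A t →ₗ[R] H) (r : ∀ {t t' : ℕ} (_ : t ≤ t'), A t →ₗ[R] A t')
    (L : ∀ t, A t →ₗ[R] V)
    (hq : ∀ {t t' : ℕ} (h : t ≤ t') x, q t' (r h x) = q t x)
    (hL : ∀ {t t' : ℕ} (h : t ≤ t') x, L t' (r h x) = L t x)
    (hs : ∀ y, ∃ t x, q t x = y) (hk : ∀ t x, L t x = 0 → q t x = 0) : Module.Finite R H := by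
  let G : Submodule R (H × V) :=
    { carrier := {y | ∃ t x, y = (q t x, L t x)}
      zero_mem' := ⟨0, 0, by rw [map_zero, map_zero]; rfl⟩
      add_mem' := by
        rintro _ _ ⟨t, x, rfl⟩ ⟨t', x', rfl⟩
        refine ⟨max t t', r (le_max_left _ _) x + r (le_max_right _ _) x', ?_⟩
        simp [hq, hL]
      smul_mem' := by
        rintro c _ ⟨t, x, rfl⟩
        exact ⟨t, c • x, by simp⟩ }
  have hinj : Function.Injective (LinearMap.snd R H V ∘ₗ G.subtype) := by
    rw [← LinearMap.ker_eq_bot, LinearMap.ker_eq_bot']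
    rintro ⟨_, t, x, rfl⟩ h
    have h' : L t x = 0 := h
    apply Subtype.ext
    simp [h', hk t x h']
  have : IsNoetherian R G := isNoetherian_of_injective _ hinj
  refine Module.Finite.of_surjective (LinearMap.fst R H V ∘ₗ G.subtype) ?_
  intro y
  obtain ⟨t, x, rfl⟩ := hs y
  exact ⟨⟨_, t, x, rfl⟩, rfl⟩

theorem LC0_finite [IsNoetherianRing R] (m : Ideal R) (M : ModuleCat.{0} R) [Module.Finite R M] :
    Module.Finite R (LC m 0 M) := by
  refine finite_of_directed (V := M) (fun t => (R ⧸ m ^ t) →ₗ[R] M) (q0 m M) (fun h => res0 m M h)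
    (fun t => LinearMap.applyₗ (Ideal.Quotient.mk _ 1)) (q0_res m M) ?_ (q0_surj m M) ?_
  · intro t t' h x
    rfl
  · intro t x h
    have : x = 0 := by
      ext
      exact h
    rw [this, map_zero]

theorem LC0_torsion (m : Ideal R) (M : ModuleCat.{0} R) (y : LC m 0 M) :
    ∃ t, ∀ p ∈ m ^ t, p • y = 0 := by
  obtain ⟨t, x, rfl⟩ := q0_surj m M y
  refine ⟨t, fun p hp => ?_⟩
  rw [← map_smul]
  have : p • x = 0 := by
    ext
    change p • x (Ideal.Quotient.mk _ 1) = 0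
    rw [← map_smul]
    have : p • (Ideal.Quotient.mk (m ^ t) 1) = 0 := by
      have h1 : p • (Ideal.Quotient.mk (m ^ t) 1) = Ideal.Quotient.mk (m ^ t) (p • 1) := rfl
      rw [h1, Ideal.Quotient.eq_zero_iff_mem]
      simpa using hp
    rw [this, map_zero]
  rw [this, map_zero]

theorem LC1_torsion (m : Ideal R) (M : ModuleCat.{0} R) (y : LC m 1 M) :
    ∃ t, ∀ p ∈ m ^ t, p • y = 0 := by
  obtain ⟨t, x, rfl⟩ := q1_surj m M y
  refine ⟨t, fun p hp => ?_⟩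
  rw [← map_smul]
  apply q1_of_mul m M t _ (x ⟨p, hp⟩)
  intro s
  rw [LinearMap.smul_apply, ← map_smul, ← map_smul]
  congr 1
  apply Subtype.ext
  simp [mul_comm]

/-- `D` has depth two in the needed sense; the kernel of `M → D` is killed by a power of `m`. -/
theorem LC1_finite [IsNoetherianRing R] (m : Ideal R) (M : ModuleCat.{0} R)
    {D : Type} [AddCommGroup D] [Module R D] [Module.Finite R D] (j : M →ₗ[R] D)
    (s : ℕ) (hs : ∀ x, j x = 0 → ∀ p ∈ m ^ s, p • x = 0)
    (hext : ∀ t (φ : (m ^ t : Ideal R) →ₗ[R] D), ∃ d : D, ∀ p, φ p = p.1 • d)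
    (huniq : ∀ t (d : D), (∀ p ∈ m ^ t, p • d = 0) → d = 0) :
    Module.Finite R (LC m 1 M) := by
  choose d hd using hext
  have hu : ∀ t (φ : (m ^ t : Ideal R) →ₗ[R] D) e, (∀ p, φ p = p.1 • e) → d t φ = e := by
    intro t φ e he
    rw [← sub_eq_zero]
    apply huniq t
    intro p hp
    rw [smul_sub, ← hd t φ ⟨p, hp⟩, ← he ⟨p, hp⟩, sub_self]
  let dL : ∀ t, ((m ^ t : Ideal R) →ₗ[R] D) →ₗ[R] D := fun t =>
    { toFun := d t
      map_add' := fun x y => hu _ _ _ (fun p => by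
        rw [LinearMap.add_apply, hd t x, hd t y, smul_add])
      map_smul' := fun r x => hu _ _ _ (fun p => by
        rw [LinearMap.smul_apply, hd t x, RingHom.id_apply, smul_comm]) }
  refine finite_of_directed (V := D ⧸ LinearMap.range j) (fun t => (m ^ t : Ideal R) →ₗ[R] M)
    (q1 m M) (fun h => res1 m M h)
    (fun t => (LinearMap.range j).mkQ ∘ₗ dL t ∘ₗ (LinearMap.compRight R j))
      (q1_res m M) ?_ (q1_surj m M) ?_
  · intro t t' h x
    change Submodule.mkQ _ _ = Submodule.mkQ _ _
    congr 1
    apply hu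
    intro p
    exact hd t (LinearMap.compRight R j x) (Submodule.inclusion (Ideal.pow_le_pow_right (I := m) h) p)
  · intro t x h
    change Submodule.mkQ (LinearMap.range j) (d t (j ∘ₗ x)) = 0 at h
    rw [Submodule.mkQ_apply, Submodule.Quotient.mk_eq_zero] at h
    obtain ⟨w, hw⟩ := h
    rw [← q1_res m M (Nat.le_add_right t s)]
    apply q1_of_mul m M (t + s) _ w
    rintro ⟨p, hp⟩
    change x ⟨p, _⟩ = p • w
    have key : ∀ p (hp : p ∈ m ^ t * m ^ s), ∃ hp' : p ∈ m ^ t, x ⟨p, hp'⟩ = p • w := by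
      intro p hp
      induction hp using Submodule.mul_induction_on' with
      | mem_mul_mem a ha b hb =>
        refine ⟨Ideal.mul_mem_right _ _ ha, ?_⟩
        have h1 : j (x ⟨a, ha⟩ - a • w) = 0 := by
          rw [map_sub, map_smul, hw, ← hd t (j ∘ₗ x) ⟨a, ha⟩]
          simp
        have h2 := hs _ h1 b hb
        rw [smul_sub, ← map_smul, sub_eq_zero] at h2
        have h3 : (a * b) • w = b • a • w := by rw [mul_comm a b, mul_smul]
        rw [h3, ← h2]
        congr 1
        apply Subtype.ext
        simp [mul_comm]
      | add a ha b hb iha ihb =>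
        obtain ⟨ha', e1⟩ := iha
        obtain ⟨hb', e2⟩ := ihb
        refine ⟨Ideal.add_mem _ ha' hb', ?_⟩
        rw [add_smul, ← e1, ← e2, ← map_add]
        rfl
    obtain ⟨_, h⟩ := key p (by rwa [← pow_add])
    exact h
end LCx

end

noncomputable section
open CategoryTheory Opposite Limits MvPolynomial
namespace LCx
variable {K : Type} [Field K] {n : ℕ}

abbrev SS (K : Type) [Field K] (n : ℕ) := MvPolynomial (Fin n) K

lemma X_mem_max (i : Fin n) : (X i : SS K n) ∈ maxIdeal K n := Ideal.subset_span ⟨i, rfl⟩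

lemma quot_finite (N : ℕ) : Module.Finite K (SS K n ⧸ (maxIdeal K n) ^ N) := by
  have : Algebra.IsIntegral K (SS K n ⧸ (maxIdeal K n) ^ N) := by
    refine ⟨fun x => ?_⟩
    obtain ⟨p, rfl⟩ := Ideal.Quotient.mk_surjective x
    induction p using MvPolynomial.induction_on with
    | C a => exact isIntegral_algebraMap (R := K) (x := a)
    | add p q hp hq => rw [map_add]; exact hp.add hq
    | mul_X p i hp =>
      rw [map_mul]
      refine hp.mul ?_
      have : (Ideal.Quotient.mk (maxIdeal K n ^ N) (X i)) ^ N = 0 := by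
        rw [← map_pow, Ideal.Quotient.eq_zero_iff_mem]
        exact Ideal.pow_mem_pow (X_mem_max i) N
      exact IsIntegral.of_pow (Nat.succ_pos N) (by rw [pow_succ, this, zero_mul]; exact isIntegral_zero)
  exact Algebra.IsIntegral.finite

lemma finite_of_torsion (H : Type) [AddCommGroup H] [Module (SS K n) H] [Module K H]
    [IsScalarTower K (SS K n) H] [Module.Finite (SS K n) H]
    (h : ∀ y : H, ∃ t, ∀ p ∈ (maxIdeal K n) ^ t, p • y = 0) : Module.Finite K H := by
  obtain ⟨r, g, hg⟩ := Module.Finite.exists_fin (R := SS K n) (M := H)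
  choose t ht using h
  let f : ((i : Fin r) → SS K n ⧸ (maxIdeal K n) ^ (t (g i))) →ₗ[SS K n] H :=
    ∑ i, (Submodule.liftQ _ (LinearMap.toSpanSingleton (SS K n) H (g i))
      (fun p hp => ht (g i) p hp)) ∘ₗ LinearMap.proj i
  have hf : Function.Surjective f := by
    rw [← LinearMap.range_eq_top, eq_top_iff, ← hg, Submodule.span_le]
    rintro _ ⟨i, rfl⟩
    refine ⟨Pi.single i (Ideal.Quotient.mk _ 1), ?_⟩
    simp only [f, LinearMap.sum_apply, LinearMap.comp_apply, LinearMap.proj_apply]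
    rw [Finset.sum_eq_single i]
    · rw [Pi.single_eq_same]
      change (1 : SS K n) • g i = g i
      simp
    · intro j _ hj
      rw [Pi.single_eq_of_ne hj, map_zero]
    · simp
  have := fun i => quot_finite (K := K) (n := n) (t (g i))
  exact Module.Finite.of_surjective (f.restrictScalars K) hf

/-! weights -/
def wt (w : Fin n → ℕ) (e : Fin n →₀ ℕ) : ℕ := ∑ j, w j * e j

lemma wt_add (w : Fin n → ℕ) (e f : Fin n →₀ ℕ) : wt w (e + f) = wt w e + wt w f := by
  simp [wt, mul_add, Finset.sum_add_distrib]

lemma wt_single (w : Fin n → ℕ) (a : Fin n) (t : ℕ) : wt w (Finsupp.single a t) = w a * t := by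
  rw [wt, Finset.sum_eq_single a] <;> simp +contextual [eq_comm]

def WI (K : Type) [Field K] {n : ℕ} (w : Fin n → ℕ) (k : ℕ) : Ideal (SS K n) where
  carrier := {f | ∀ e, coeff e f ≠ 0 → k ≤ wt w e}
  zero_mem' := by simp
  add_mem' := by
    intro a b ha hb e he
    by_cases h : coeff e a = 0
    · apply hb e; intro h2; simp [h, h2] at he
    · exact ha e h
  smul_mem' := by
    intro c x hx e he
    rw [smul_eq_mul, coeff_mul] at he
    obtain ⟨⟨u, v⟩, huv, h⟩ := Finset.exists_ne_zero_of_sum_ne_zero he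
    rw [Finset.HasAntidiagonal.mem_antidiagonal] at huv
    have := hx v (right_ne_zero_of_mul h)
    simp only at huv
    rw [← huv, wt_add]; omega

lemma mem_WI {w : Fin n → ℕ} {k : ℕ} {f : SS K n} :
    f ∈ WI K w k ↔ ∀ e, coeff e f ≠ 0 → k ≤ wt w e := Iff.rfl

lemma WI_mul (w : Fin n → ℕ) (k l : ℕ) : WI K w k * WI K w l ≤ WI K w (k + l) := by
  rw [Ideal.mul_le]
  intro a ha b hb e he
  rw [coeff_mul] at he
  obtain ⟨⟨u, v⟩, huv, h⟩ := Finset.exists_ne_zero_of_sum_ne_zero he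
  rw [Finset.HasAntidiagonal.mem_antidiagonal] at huv
  have h1 := ha u (left_ne_zero_of_mul h)
  have h2 := hb v (right_ne_zero_of_mul h)
  simp only at huv
  rw [← huv, wt_add]; omega

lemma WI_pow (w : Fin n → ℕ) (k : ℕ) (m : ℕ) : (WI K w k) ^ m ≤ WI K w (k * m) := by
  induction m with
  | zero => intro f _ e _; simp
  | succ m ih =>
    rw [pow_succ, mul_add, mul_one]
    exact (Ideal.mul_mono_left ih).trans (WI_mul w _ _)

lemma faceMonomial_eq (F : Finset (Fin n)) :
    faceMonomial K F = monomial (∑ i ∈ F, Finsupp.single i 1) (1 : K) := by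
  rw [faceMonomial, monomial_sum_one]
  rfl

lemma wt_sum (w : Fin n → ℕ) (F : Finset (Fin n)) :
    wt w (∑ i ∈ F, Finsupp.single i 1) = ∑ i ∈ F, w i := by
  classical
  induction F using Finset.induction_on with
  | empty => simp [wt]
  | insert a s ha ih => rw [Finset.sum_insert ha, Finset.sum_insert ha, wt_add, wt_single, ih, mul_one]

lemma mono_mem_WI {w : Fin n → ℕ} {k : ℕ} {e : Fin n →₀ ℕ} {a : K} (h : k ≤ wt w e) :
    monomial e a ∈ WI K w k := by
  classical
  intro f hf
  rw [coeff_monomial] at hf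
  split_ifs at hf with h1
  · rw [← h1]; exact h
  · exact absurd rfl hf

lemma SR_le_WI (Δ : SimComplex n) (w : Fin n → ℕ) (k : ℕ)
    (h : ∀ G, G ∉ Δ.faces → k ≤ ∑ i ∈ G, w i) : SRIdeal K Δ ≤ WI K w k := by
  rw [SRIdeal, Ideal.span_le]
  rintro p ⟨G, hG, rfl⟩
  rw [faceMonomial_eq]
  exact mono_mem_WI (by rw [wt_sum]; exact h G hG)

lemma SRpow_le_WI (Δ : SimComplex n) (w : Fin n → ℕ) (k m : ℕ)
    (h : ∀ G, G ∉ Δ.faces → k ≤ ∑ i ∈ G, w i) : SRIdeal K Δ ^ m ≤ WI K w (k * m) :=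
  (Ideal.pow_right_mono (SR_le_WI Δ w k h) m).trans (WI_pow w k m)

lemma WI_reg {w : Fin n → ℕ} {k : ℕ} {a : Fin n} (ha : w a = 0) (t : ℕ) {f : SS K n}
    (h : X a ^ t * f ∈ WI K w k) : f ∈ WI K w k := by
  intro e he
  have := h (Finsupp.single a t + e) (by
    rw [X_pow_eq_monomial, coeff_monomial_mul, one_mul]; exact he)
  rw [wt_add, wt_single, ha] at this
  omega

lemma Xpow_mem (a : Fin n) (t : ℕ) : (X a ^ t : SS K n) ∈ maxIdeal K n ^ t :=
  Ideal.pow_mem_pow (X_mem_max a) t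

lemma WI_uniq {w : Fin n → ℕ} {k : ℕ} {a : Fin n} (ha : w a = 0) (t : ℕ) (d : SS K n ⧸ WI K w k)
    (h : ∀ p ∈ maxIdeal K n ^ t, p • d = 0) : d = 0 := by
  obtain ⟨f, rfl⟩ := Ideal.Quotient.mk_surjective d
  have := h _ (Xpow_mem a t)
  rw [Ideal.Quotient.eq_zero_iff_mem]
  apply WI_reg ha t
  rw [← Ideal.Quotient.eq_zero_iff_mem, ← this]
  rfl

lemma WI_ext {w : Fin n → ℕ} {k : ℕ} {a b : Fin n} (hab : a ≠ b) (ha : w a = 0) (hb : w b = 0)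
    (t : ℕ) (φ : (maxIdeal K n ^ t : Ideal (SS K n)) →ₗ[SS K n] (SS K n ⧸ WI K w k)) :
    ∃ d, ∀ p, φ p = p.1 • d := by
  obtain ⟨g, hg⟩ := Ideal.Quotient.mk_surjective (φ ⟨X a ^ t, Xpow_mem a t⟩)
  obtain ⟨h, hh⟩ := Ideal.Quotient.mk_surjective (φ ⟨X b ^ t, Xpow_mem b t⟩)
  have h1 : X b ^ t * g - X a ^ t * h ∈ WI K w k := by
    rw [← Ideal.Quotient.eq_zero_iff_mem, map_sub, map_mul, map_mul, hg, hh]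
    change (X b ^ t : SS K n) • φ _ - (X a ^ t : SS K n) • φ _ = 0
    rw [← map_smul, ← map_smul, sub_eq_zero]
    congr 1
    ext1
    simp [mul_comm]
  set s := Finsupp.single a t with hs
  have hdm := divMonomial_add_modMonomial g s
  have hr : g.modMonomial s ∈ WI K w k := by
    intro e he
    have hle : ¬ s ≤ e := by
      intro hle
      exact he (coeff_modMonomial_of_le _ hle)
    rw [coeff_modMonomial_of_not_le _ hle] at he
    have hle2 : ¬ s ≤ Finsupp.single b t + e := by
      rw [hs, Finsupp.single_le_iff] at hle ⊢
      simpa [Finsupp.single_apply, hab.symm] using hle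
    have := h1 (Finsupp.single b t + e) (by
      rw [coeff_sub, X_pow_eq_monomial, X_pow_eq_monomial, coeff_monomial_mul, one_mul,
        coeff_monomial_mul', if_neg hle2, sub_zero]; exact he)
    rw [wt_add, wt_single, hb] at this
    omega
  refine ⟨Ideal.Quotient.mk _ (g.divMonomial s), fun p => ?_⟩
  obtain ⟨f, hf⟩ := Ideal.Quotient.mk_surjective (φ p)
  rw [← hf]
  change _ = Ideal.Quotient.mk (WI K w k) (p.1 * g.divMonomial s)
  rw [Ideal.Quotient.eq]
  apply WI_reg ha t
  have h2 : X a ^ t * f - p.1 * g ∈ WI K w k := by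
    rw [← Ideal.Quotient.eq_zero_iff_mem, map_sub, map_mul, map_mul, hg, hf]
    change (X a ^ t : SS K n) • φ p - (p.1 : SS K n) • φ _ = 0
    rw [← map_smul, ← map_smul, sub_eq_zero]
    congr 1
    ext1
    simp [mul_comm]
  have h3 := (WI K w k).add_mem h2 ((WI K w k).mul_mem_left p.1 hr)
  convert h3 using 1
  rw [X_pow_eq_monomial]
  linear_combination (-p.1) * hdm

end LCx

end

noncomputable section
open CategoryTheory Opposite Limits MvPolynomial
namespace LCx
variable {K : Type} [Field K] {n : ℕ}

def wF (F : Finset (Fin n)) : Fin n → ℕ := fun j => if j ∈ F then 0 else 1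

lemma SRpow_le_wF (Δ : SimComplex n) {F : Finset (Fin n)} (hF : F ∈ Δ.faces) (m : ℕ) :
    SRIdeal K Δ ^ m ≤ WI K (wF F) m := by
  have := SRpow_le_WI (K := K) Δ (wF F) 1 m (by
    intro G hG
    by_contra hc
    apply hG
    apply Δ.down_closed hF
    intro i hi
    by_contra hiF
    apply hc
    have : wF F i ≤ ∑ i ∈ G, wF F i := Finset.single_le_sum (fun _ _ => Nat.zero_le _) hi
    rw [wF, if_neg hiF] at this
    exact this)
  rwa [one_mul] at this

/-- pair monomials in I -/
lemma faceMon_mem (Δ : SimComplex n) {G : Finset (Fin n)} (hG : G ∉ Δ.faces) :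
    faceMonomial K G ∈ SRIdeal K Δ := Ideal.subset_span ⟨G, hG, rfl⟩

lemma mono_dvd {e e' : Fin n →₀ ℕ} {I : Ideal (SS K n)} (h : e ≤ e') (he : monomial e (1 : K) ∈ I) (a : K) :
    monomial e' a ∈ I := by
  have : monomial e' a = monomial (e' - e) a * monomial e (1 : K) := by
    rw [monomial_mul, mul_one, tsub_add_cancel_of_le h]
  rw [this]; exact I.mul_mem_left _ he

lemma prod_mem (Δ : SimComplex n) (v : Fin n) (T : Finset (Fin n)) (hT : ∀ j ∈ T, X v * X j ∈ SRIdeal K Δ)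
    (e : Fin n → ℕ) (k : ℕ) (hk : k ≤ ∑ j ∈ T, e j) :
    X v ^ k * ∏ j ∈ T, (X j : SS K n) ^ e j ∈ SRIdeal K Δ ^ k := by
  classical
  induction T using Finset.induction_on generalizing k with
  | empty =>
    simp only [Finset.sum_empty, nonpos_iff_eq_zero] at hk
    subst hk; simp
  | insert a s ha ih =>
    rw [Finset.sum_insert ha] at hk
    rw [Finset.prod_insert ha]
    have hs := fun j hj => hT j (Finset.mem_insert_of_mem hj)
    rcases le_total k (∑ j ∈ s, e j) with h | h
    · have := Ideal.mul_mem_left _ (X a ^ e a) (ih hs k h)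
      convert this using 1
      ring
    · obtain ⟨r, rfl⟩ := Nat.exists_eq_add_of_le h
      obtain ⟨u, hu⟩ := Nat.exists_eq_add_of_le (show r ≤ e a by omega)
      have h1 := Ideal.mul_mem_mul (ih hs _ le_rfl) (Ideal.pow_mem_pow (hT a (Finset.mem_insert_self _ _)) r)
      rw [← pow_add] at h1
      have h2 := Ideal.mul_mem_left _ (X a ^ u) h1
      convert h2 using 1
      rw [hu]
      ring

lemma mono_prod (e : Fin n →₀ ℕ) (T : Finset (Fin n)) :
    ∃ q : SS K n, monomial e (1:K) = q * ∏ j ∈ T, X j ^ e j := by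
  classical
  refine ⟨∏ j ∈ Tᶜ, X j ^ e j, ?_⟩
  rw [mul_comm, Finset.prod_mul_prod_compl, monomial_eq, C_1, one_mul, Finsupp.prod_fintype _ _ (by simp)]

lemma pair_mem (Δ : SimComplex n) {v j : Fin n} (h : v ≠ j) (hn : ¬ Δ.Adj v j) :
    (X v * X j : SS K n) ∈ SRIdeal K Δ := by
  classical
  have := faceMon_mem (K := K) Δ (G := {v, j}) (fun hc => hn ⟨h, hc⟩)
  rwa [faceMonomial, Finset.prod_pair h] at this

lemma triple_mem (Δ : SimComplex n) (hgraph : ∀ F ∈ Δ.faces, F.card ≤ 2) {v a b : Fin n}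
    (h : v ≠ a) (h' : v ≠ b) (hab : a ≠ b) :
    (X v * X a * X b : SS K n) ∈ SRIdeal K Δ := by
  classical
  have := faceMon_mem (K := K) Δ (G := {v, a, b}) (fun hc => by
    have := hgraph _ hc
    rw [Finset.card_eq_three.2 ⟨v, a, b, h, h', hab, rfl⟩] at this
    omega)
  rw [faceMonomial, Finset.prod_insert (by simp [h, h']), Finset.prod_pair hab, ← mul_assoc] at this
  exact this

lemma wt_wF (F : Finset (Fin n)) (e : Fin n →₀ ℕ) : wt (wF F) e = ∑ j ∈ Fᶜ, e j := by
  classical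
  rw [wt, ← Finset.sum_add_sum_compl F]
  rw [Finset.sum_eq_zero, zero_add]
  · apply Finset.sum_congr rfl
    intro j hj
    rw [wF, if_neg (Finset.mem_compl.1 hj), one_mul]
  · intro j hj; rw [wF, if_pos hj, zero_mul]

lemma key_mono (Δ : SimComplex n) (hgraph : ∀ F ∈ Δ.faces, F.card ≤ 2) (m : ℕ) (v a b : Fin n)
    (ha : Δ.Adj v a) (hb : Δ.Adj v b) (hN : ∀ j, Δ.Adj v j → j = a ∨ j = b)
    (e : Fin n →₀ ℕ) (h1 : m ≤ wt (wF {v, a}) e) (h2 : m ≤ wt (wF {v, b}) e) :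
    X v ^ m * monomial e (1 : K) ∈ SRIdeal K Δ ^ m := by
  classical
  rw [wt_wF] at h1 h2
  by_cases hab : a = b
  · subst hab
    obtain ⟨q, hq⟩ := mono_prod (K := K) e ({v, a}ᶜ)
    have h3 := prod_mem (K := K) Δ v ({v, a}ᶜ) (fun j hj => by
      simp only [Finset.mem_compl, Finset.mem_insert, Finset.mem_singleton, not_or] at hj
      exact pair_mem Δ (Ne.symm hj.1) (fun hc => by have := hN j hc; tauto)) e m h1
    rw [hq]
    convert Ideal.mul_mem_left _ q h3 using 1
    ring
  · have hva := ha.1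
    have hvb := hb.1
    set T : Finset (Fin n) := {v, a, b}ᶜ with hTdef
    have hTa : a ∉ T := by simp [hTdef]
    have hTb : b ∉ T := by simp [hTdef]
    have e1 : ({v, a}ᶜ : Finset (Fin n)) = insert b T := by
      ext j; simp only [hTdef, Finset.mem_compl, Finset.mem_insert, Finset.mem_singleton]
      have : j = b → j ≠ v ∧ j ≠ a := by rintro rfl; exact ⟨hvb.symm, Ne.symm hab⟩
      tauto
    have e2 : ({v, b}ᶜ : Finset (Fin n)) = insert a T := by
      ext j; simp only [hTdef, Finset.mem_compl, Finset.mem_insert, Finset.mem_singleton]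
      have : j = a → j ≠ v ∧ j ≠ b := by rintro rfl; exact ⟨hva.symm, hab⟩
      tauto
    rw [e1, Finset.sum_insert hTb] at h1
    rw [e2, Finset.sum_insert hTa] at h2
    obtain ⟨q, hq⟩ := mono_prod (K := K) e (insert a (insert b T))
    rw [Finset.prod_insert (by simp [hab, hTa]), Finset.prod_insert hTb] at hq
    have hpair : ∀ j ∈ T, (X v * X j : SS K n) ∈ SRIdeal K Δ := fun j hj => by
      simp only [hTdef, Finset.mem_compl, Finset.mem_insert, Finset.mem_singleton, not_or] at hj
      exact pair_mem Δ (Ne.symm hj.1) (fun hc => by have := hN j hc; tauto)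
    obtain ⟨k, l, hkl, hk, hla, hlb⟩ : ∃ k l, m = k + l ∧ k ≤ ∑ j ∈ T, e j ∧ l ≤ e a ∧ l ≤ e b := by
      refine ⟨min m (∑ j ∈ T, e j), m - min m (∑ j ∈ T, e j), ?_⟩
      omega
    obtain ⟨u, hu⟩ := Nat.exists_eq_add_of_le hla
    obtain ⟨u', hu'⟩ := Nat.exists_eq_add_of_le hlb
    have h3 := Ideal.mul_mem_mul (prod_mem (K := K) Δ v T hpair e k hk)
      (Ideal.pow_mem_pow (triple_mem (K := K) Δ hgraph hva hvb hab) l)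
    rw [← pow_add, ← hkl] at h3
    rw [hq, hu, hu', hkl]
    rw [hkl] at h3
    convert Ideal.mul_mem_left _ (q * X a ^ u * X b ^ u') h3 using 1
    ring

lemma key_poly (Δ : SimComplex n) (hgraph : ∀ F ∈ Δ.faces, F.card ≤ 2) (m : ℕ) (v a b : Fin n)
    (ha : Δ.Adj v a) (hb : Δ.Adj v b) (hN : ∀ j, Δ.Adj v j → j = a ∨ j = b)
    (f : SS K n) (h1 : f ∈ WI K (wF {v, a}) m) (h2 : f ∈ WI K (wF {v, b}) m) :
    X v ^ m * f ∈ SRIdeal K Δ ^ m := by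
  rw [f.as_sum, Finset.mul_sum]
  refine Ideal.sum_mem _ (fun e he => ?_)
  rw [mem_support_iff] at he
  have := key_mono (K := K) Δ hgraph m v a b ha hb hN e (h1 e he) (h2 e he)
  have h3 := Ideal.mul_mem_left _ (C (coeff e f)) this
  convert h3 using 1
  rw [mul_left_comm, C_mul_monomial, mul_one]

lemma fg_max : (maxIdeal K n).FG := (isNoetherian_def.1 inferInstance) _

/-- torsion of the kernel -/
lemma ker_torsion (Δ : SimComplex n) (hgraph : ∀ F ∈ Δ.faces, F.card ≤ 2)
    (hdeg : ∀ v, ∃ a b, Δ.Adj v a ∧ Δ.Adj v b ∧ ∀ j, Δ.Adj v j → j = a ∨ j = b) (m : ℕ) :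
    ∃ s, ∀ f : SS K n, (∀ F ∈ Δ.faces, F.card = 2 → f ∈ WI K (wF F) m) →
      ∀ p ∈ maxIdeal K n ^ s, p * f ∈ SRIdeal K Δ ^ m := by
  classical
  let J : Ideal (SS K n) := ⨅ (F : Finset (Fin n)) (_ : F ∈ Δ.faces ∧ F.card = 2), WI K (wF F) m
  have hrad : maxIdeal K n ≤ ((SRIdeal K Δ ^ m).colon (J : Set (SS K n))).radical := by
    rw [maxIdeal, Ideal.span_le]
    rintro _ ⟨v, rfl⟩
    refine ⟨m, ?_⟩
    rw [Submodule.mem_colon]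
    intro f hf
    obtain ⟨a, b, ha, hb, hN⟩ := hdeg v
    have hf' : ∀ c, Δ.Adj v c → f ∈ WI K (wF {v, c}) m := fun c hc => by
      have hf2 : f ∈ J := hf
      simp only [J, Ideal.mem_iInf] at hf2
      exact hf2 {v, c} ⟨hc.2, Finset.card_pair hc.1⟩
    exact key_poly Δ hgraph m v a b ha hb hN f (hf' a ha) (hf' b hb)
  obtain ⟨s, hs⟩ := Ideal.exists_pow_le_of_le_radical_of_fg hrad fg_max
  refine ⟨s, fun f hf p hp => ?_⟩
  have := hs hp
  rw [Submodule.mem_colon] at this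
  exact this f (by
    change f ∈ J
    simp only [J, Ideal.mem_iInf]
    exact fun F hF => hf F hF.1 hF.2)

theorem LC1_fin (Δ : SimComplex n) (hgraph : ∀ F ∈ Δ.faces, F.card ≤ 2)
    (hdeg : ∀ v, ∃ a b, Δ.Adj v a ∧ Δ.Adj v b ∧ ∀ j, Δ.Adj v j → j = a ∨ j = b) (m : ℕ) :
    Module.Finite (SS K n) (LC (maxIdeal K n) 1 (ModuleCat.of (SS K n) (SS K n ⧸ (SRIdeal K Δ ^ m)))) := by
  classical
  obtain ⟨s, hs⟩ := ker_torsion (K := K) Δ hgraph hdeg m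
  let ι := {F : Finset (Fin n) // F ∈ Δ.faces ∧ F.card = 2}
  let j : (SS K n ⧸ (SRIdeal K Δ ^ m)) →ₗ[SS K n] ((F : ι) → SS K n ⧸ WI K (wF F.1) m) :=
    LinearMap.pi (fun F => Submodule.mapQ _ _ LinearMap.id (SRpow_le_wF Δ F.2.1 m))
  have hι : ∀ F : ι, ∃ a b : Fin n, a ≠ b ∧ wF F.1 a = 0 ∧ wF F.1 b = 0 := by
    rintro ⟨F, hF, hc⟩
    obtain ⟨a, b, hab, rfl⟩ := Finset.card_eq_two.1 hc
    exact ⟨a, b, hab, by simp [wF], by simp [wF]⟩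
  refine LC1_finite (maxIdeal K n) (ModuleCat.of (SS K n) (SS K n ⧸ (SRIdeal K Δ ^ m))) j s ?_ ?_ ?_
  · intro x hx p hp
    obtain ⟨f, rfl⟩ := Ideal.Quotient.mk_surjective x
    have h2 := hs f (fun F hF hc => by
      have := congrFun hx ⟨F, hF, hc⟩
      exact (Ideal.Quotient.eq_zero_iff_mem).1 this) p hp
    exact (Ideal.Quotient.eq_zero_iff_mem).2 h2
  · intro t φ
    have : ∀ F : ι, ∃ d, ∀ p, (LinearMap.proj F ∘ₗ φ) p = p.1 • d := fun F => by
      obtain ⟨a, b, hab, ha, hb⟩ := hι F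
      exact WI_ext hab ha hb t _
    choose d hd using this
    exact ⟨d, fun p => funext fun F => hd F p⟩
  · intro t d h
    funext F
    obtain ⟨a, b, hab, ha, hb⟩ := hι F
    exact WI_uniq ha t (d F) (fun p hp => congrFun (h p hp) F)

theorem LCK_finite (i : ℕ) (I : Ideal (SS K n))
    (h : Module.Finite (SS K n) (LC (maxIdeal K n) i (ModuleCat.of (SS K n) (SS K n ⧸ I))))
    (h' : ∀ y : LC (maxIdeal K n) i (ModuleCat.of (SS K n) (SS K n ⧸ I)), ∃ t, ∀ p ∈ (maxIdeal K n) ^ t, p • y = 0) :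
    Module.Finite K (RestrictScalars K (SS K n) (locCoh K i I)) := by
  let M1 : Module (SS K n) (RestrictScalars K (SS K n) (locCoh K i I)) :=
    RestrictScalars.moduleOrig K (SS K n) (locCoh K i I)
  have t1 : IsScalarTower K (SS K n) (RestrictScalars K (SS K n) (locCoh K i I)) :=
    RestrictScalars.isScalarTower _ _ _
  have t2 : Module.Finite (SS K n) (RestrictScalars K (SS K n) (locCoh K i I)) := h
  exact @finite_of_torsion K _ n (RestrictScalars K (SS K n) (locCoh K i I)) _ M1 (RestrictScalars.module K (SS K n) (locCoh K i I)) t1 t2 h'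

theorem genCM_of_deg (Δ : SimComplex n) (hgraph : ∀ F ∈ Δ.faces, F.card ≤ 2)
    (hdeg : ∀ v, ∃ a b, Δ.Adj v a ∧ Δ.Adj v b ∧ ∀ j, Δ.Adj v j → j = a ∨ j = b) (m : ℕ)
    (hdim : ringKrullDim (SS K n ⧸ (SRIdeal K Δ ^ m)) ≤ 2) :
    IsGeneralizedCM K (SRIdeal K Δ ^ m) := by
  intro i hi
  have : (i : WithBot ℕ∞) < ((2 : ℕ) : WithBot ℕ∞) := lt_of_lt_of_le hi hdim
  have : i < 2 := by exact_mod_cast this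
  have : IsNoetherianRing (SS K n) := inferInstance
  interval_cases i
  · exact LCK_finite 0 _ (LC0_finite _ _) (LC0_torsion _ _)
  · exact LCK_finite 1 _ (LC1_fin Δ hgraph hdeg m) (LC1_torsion _ _)

end LCx

end

noncomputable section
open CategoryTheory Opposite Limits MvPolynomial
namespace LCx
variable {K : Type} [Field K] {n : ℕ}

abbrev MQ (I : Ideal (SS K n)) : ModuleCat (SS K n) := ModuleCat.of (SS K n) (SS K n ⧸ I)

lemma max_pow_WI (t : ℕ) : maxIdeal K n ^ t ≤ WI K (fun _ => 1) t := by
  have h : maxIdeal K n ≤ WI K (fun _ => 1) 1 := by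
    rw [maxIdeal, Ideal.span_le]
    rintro _ ⟨i, rfl⟩
    exact mono_mem_WI (by rw [wt_single])
  have := (Ideal.pow_right_mono h t).trans (WI_pow _ 1 t)
  rwa [one_mul] at this

lemma wF_pos {v : Fin n} {e : Fin n →₀ ℕ} (h : 1 ≤ wt (wF {v}) e) : ∃ j, j ≠ v ∧ 1 ≤ e j := by
  classical
  rw [wt_wF] at h
  by_contra hc
  push Not at hc
  rw [Finset.sum_eq_zero] at h
  · omega
  · intro j hj
    have := hc j (by simpa using hj)
    omega

/-- `P_v` kills `z` -/
lemma P_kill {I : Ideal (SS K n)} {v : Fin n} {z : SS K n} (hz : ∀ j, j ≠ v → X j * z ∈ I) {f : SS K n}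
    (hf : f ∈ WI K (wF {v}) 1) : f * z ∈ I := by
  rw [f.as_sum, Finset.sum_mul]
  refine Ideal.sum_mem _ (fun e he => ?_)
  rw [mem_support_iff] at he
  obtain ⟨j, hj, hej⟩ := wF_pos (hf e he)
  have : monomial e (coeff e f) = monomial (e - Finsupp.single j 1) (coeff e f) * X j := by
    rw [X, monomial_mul, mul_one, tsub_add_cancel_of_le]
    rwa [Finsupp.single_le_iff]
  rw [this, mul_assoc]
  exact I.mul_mem_left _ (hz j hj)

lemma mod_mem {v : Fin n} {k t : ℕ} (hk : k ≤ t) {p : SS K n} (hp : p ∈ maxIdeal K n ^ t) :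
    p.modMonomial (Finsupp.single v k) ∈ WI K (wF {v}) 1 := by
  classical
  intro e he
  have hle : ¬ Finsupp.single v k ≤ e := fun hle => he (coeff_modMonomial_of_le _ hle)
  rw [coeff_modMonomial_of_not_le _ hle] at he
  have h1 := max_pow_WI t hp e he
  rw [Finsupp.single_le_iff] at hle
  rw [wt_wF]
  simp only [wt, one_mul] at h1
  rw [← Finset.sum_add_sum_compl {v}, Finset.sum_singleton] at h1
  omega

lemma div_mem {v : Fin n} {k : ℕ} {p : SS K n} (hp : p ∈ WI K (wF {v}) 1) :
    p.divMonomial (Finsupp.single v k) ∈ WI K (wF {v}) 1 := by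
  intro e he
  rw [coeff_divMonomial] at he
  have := hp _ he
  rw [wt_add, wt_single] at this
  simpa [wF] using this

def psi (I : Ideal (SS K n)) (v : Fin n) (z : SS K n) (hz : ∀ j, j ≠ v → X j * z ∈ I) (k t : ℕ)
    (hk : k ≤ t) : (maxIdeal K n ^ t : Ideal (SS K n)) →ₗ[SS K n] (MQ I) where
  toFun p := (Ideal.Quotient.mk I (p.1.divMonomial (Finsupp.single v k) * z) : SS K n ⧸ I)
  map_add' p q := by
    change (Ideal.Quotient.mk I ((p.1 + q.1).divMonomial (Finsupp.single v k) * z) : SS K n ⧸ I) = _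
    rw [add_divMonomial, add_mul, map_add]
  map_smul' f p := by
    change (Ideal.Quotient.mk I ((f * p.1).divMonomial (Finsupp.single v k) * z) : SS K n ⧸ I) =
      Ideal.Quotient.mk I (f * (p.1.divMonomial (Finsupp.single v k) * z))
    rw [Ideal.Quotient.eq]
    set s := Finsupp.single v k
    have h1 := divMonomial_add_modMonomial p.1 s
    have h2 : (f * p.1).divMonomial s = f * p.1.divMonomial s + (f * p.1.modMonomial s).divMonomial s := by
      conv_lhs => rw [← h1, mul_add, add_divMonomial, mul_left_comm, divMonomial_monomial_mul]
    rw [h2]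
    have h3 := P_kill (I := I) hz (div_mem (k := k) (Ideal.mul_mem_left _ f (mod_mem (v := v) hk p.2)))
    convert h3 using 1
    ring

theorem infinite_of_family (H : Type) [AddCommGroup H] [Module (SS K n) H] [Module K H]
    [IsScalarTower K (SS K n) H] (h : ∀ N, ∃ y : Fin N → H, ∀ g : Fin N → K,
      ∑ k, (C (g k) : SS K n) • y k = 0 → ∀ k, g k = 0) : ¬ Module.Finite K H := by
  intro hfin
  obtain ⟨y, hy⟩ := h (Module.finrank K H + 1)
  have hl : LinearIndependent K y := by
    rw [Fintype.linearIndependent_iff]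
    intro g hg
    apply hy
    rw [← hg]
    refine Finset.sum_congr rfl (fun k _ => ?_)
    rw [← algebraMap_smul (SS K n) (g k) (y k)]
    rfl
  have := hl.fintype_card_le_finrank
  simp at this

theorem lin_indep (I : Ideal (SS K n)) (v : Fin n) (ez : Fin n →₀ ℕ)
    (hz : ∀ j, j ≠ v → X j * monomial ez (1 : K) ∈ I) (w : Fin n → ℕ) (L : ℕ)
    (hI : I ≤ WI K w L) (hwv : w v = 0) (hw : wt w ez < L) (N : ℕ) :
    ∃ y : Fin N → LC (maxIdeal K n) 1 (MQ I), ∀ g : Fin N → K,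
      ∑ k, (C (g k) : SS K n) • y k = 0 → ∀ k, g k = 0 := by
  classical
  refine ⟨fun k : Fin N => q1 (maxIdeal K n) (MQ I) (ez v + 1 + N)
      (psi I v (monomial ez 1) hz (ez v + 1 + k) (ez v + 1 + N) (by omega)), ?_⟩
  intro g hg k0
  set t := ez v + 1 + N with ht
  set P : Fin N → ((maxIdeal K n ^ t : Ideal (SS K n)) →ₗ[SS K n] (MQ I)) := fun k =>
    psi I v (monomial ez 1) hz (ez v + 1 + k) t (by omega) with hP
  have h1 : q1 (maxIdeal K n) (MQ I) t (∑ k, (C (g k) : SS K n) • P k) = 0 := by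
    rw [map_sum]
    simp_rw [map_smul]
    exact hg
  obtain ⟨t', htt, y, hy⟩ := q1_zero _ _ _ _ h1
  obtain ⟨f, rfl⟩ := Ideal.Quotient.mk_surjective (I := I) y
  have h2 := hy ⟨X v ^ t', Xpow_mem v t'⟩
  have h3 : (Ideal.Quotient.mk I (∑ k, C (g k) * (monomial (Finsupp.single v (t' - (ez v + 1 + k))) 1 * monomial ez (1 : K)))) =
      Ideal.Quotient.mk I (X v ^ t' * f) := by
    refine Eq.trans ?_ h2
    rw [map_sum]
    change _ = (∑ k, (C (g k) : SS K n) • P k) ⟨X v ^ t', _⟩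
    rw [LinearMap.sum_apply]
    refine Finset.sum_congr rfl (fun k _ => ?_)
    change _ = Ideal.Quotient.mk I (C (g k) * ((X v ^ t' : SS K n).divMonomial (Finsupp.single v (ez v + 1 + k)) * monomial ez (1 : K)))
    congr 3
    rw [X_pow_eq_monomial]
    have : Finsupp.single v t' = Finsupp.single v (ez v + 1 + k) + Finsupp.single v (t' - (ez v + 1 + k)) := by
      rw [← Finsupp.single_add]
      congr 1
      omega
    rw [this, ← divMonomial_monomial_mul (Finsupp.single v (ez v + 1 + k)) (monomial (Finsupp.single v (t' - (ez v + 1 + k))) (1 : K)),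
      monomial_mul, one_mul]
  rw [Ideal.Quotient.eq] at h3
  by_contra hne
  have h4 := hI h3 (Finsupp.single v (t' - (ez v + 1 + k0)) + ez) ?_
  · rw [wt_add, wt_single, hwv] at h4
    omega
  · rw [coeff_sub, X_pow_eq_monomial, coeff_monomial_mul', if_neg, sub_zero, coeff_sum,
      Finset.sum_eq_single k0]
    · rw [monomial_mul, coeff_C_mul, coeff_monomial, if_pos rfl]
      simpa using hne
    · intro k _ hk
      rw [monomial_mul, coeff_C_mul, coeff_monomial, if_neg, mul_zero]
      intro h
      have := congrArg (fun e => e v) h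
      simp at this
      apply hk
      ext
      omega
    · simp
    · rw [Finsupp.single_le_iff]
      simp
      omega

theorem LC1_infinite (I : Ideal (SS K n)) (v : Fin n) (ez : Fin n →₀ ℕ)
    (hz : ∀ j, j ≠ v → X j * monomial ez (1 : K) ∈ I) (w : Fin n → ℕ) (L : ℕ)
    (hI : I ≤ WI K w L) (hwv : w v = 0) (hw : wt w ez < L) :
    ¬ Module.Finite K (RestrictScalars K (SS K n) (locCoh K 1 I)) := by
  exact @infinite_of_family K _ n (RestrictScalars K (SS K n) (locCoh K 1 I)) _
    (RestrictScalars.moduleOrig K (SS K n) (locCoh K 1 I))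
    (RestrictScalars.module K (SS K n) (locCoh K 1 I))
    (RestrictScalars.isScalarTower _ _ _) (lin_indep I v ez hz w L hI hwv hw)

theorem not_genCM (Δ : SimComplex n) (hV : ∀ i : Fin n, ({i} : Finset (Fin n)) ∈ Δ.faces)
    (hgraph : ∀ F ∈ Δ.faces, F.card ≤ 2) (m : ℕ) (hm : 2 ≤ m)
    (hdim : 1 < ringKrullDim (SS K n ⧸ (SRIdeal K Δ ^ m))) (v a b c : Fin n) (ha : Δ.Adj v a) (hb : Δ.Adj v b)
    (hc : Δ.Adj v c) (hab : a ≠ b) (hac : a ≠ c) (hbc : b ≠ c) :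
    ¬ IsGeneralizedCM K (SRIdeal K Δ ^ m) := by
  classical
  intro h
  have h1 := h 1 (by exact_mod_cast hdim)
  obtain ⟨r, rfl⟩ := Nat.exists_eq_add_of_le' hm
  have va := ha.1
  have vb := hb.1
  have vc := hc.1
  set ez : Fin n →₀ ℕ := Finsupp.single v (r + 2) + Finsupp.single a (r + 1) + Finsupp.single b (r + 1) +
    Finsupp.single c 1 with hez
  have hz : (monomial ez (1 : K)) = X v ^ (r + 2) * X a ^ (r + 1) * X b ^ (r + 1) * X c := by
    rw [X_pow_eq_monomial, X_pow_eq_monomial, X_pow_eq_monomial, X, monomial_mul, monomial_mul, monomial_mul]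
    simp [hez]
  set w : Fin n → ℕ := fun j => if j = v then 0 else if j = a ∨ j = b ∨ j = c then 1 else 2 with hw
  have hwv : w v = 0 := by simp [hw]
  have hwa : w a = 1 := by simp [hw, va.symm]
  have hwb : w b = 1 := by simp [hw, vb.symm]
  have hwc : w c = 1 := by simp [hw, vc.symm]
  have hT : ∀ i j : Fin n, i ≠ v → j ≠ v → i ≠ j → X v * X i * X j ∈ SRIdeal K Δ := fun i j hi hj hij =>
    triple_mem Δ hgraph hi.symm hj.symm hij
  refine LC1_infinite (SRIdeal K Δ ^ (r + 2)) v ez ?_ w (2 * (r + 2)) (SRpow_le_WI Δ w 2 (r + 2) ?_) hwv ?_ h1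
  · intro j hj
    rw [hz]
    have e0 := Ideal.pow_mem_pow (hT a b va.symm vb.symm hab) r
    have e1 := Ideal.pow_mem_pow (hT a b va.symm vb.symm hab) (r + 1)
    by_cases hjc : j = c
    · subst hjc
      have := Ideal.mul_mem_mul e0 (Ideal.mul_mem_mul (hT a j va.symm hj hac) (hT b j vb.symm hj hbc))
      rw [← pow_two, ← pow_add] at this
      convert this using 1
      ring
    · have := Ideal.mul_mem_mul e1 (hT c j vc.symm hj (Ne.symm hjc))
      rw [← pow_succ] at this
      convert this using 1
      ring
  · intro G hG
    by_contra hlt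
    push Not at hlt
    apply hG
    -- every element of G other than v has weight ≥ 1
    by_cases hex : ∃ i ∈ G, i ≠ v
    · obtain ⟨i, hi, hiv⟩ := hex
      have hi1 : w i ≤ ∑ j ∈ G, w j := Finset.single_le_sum (fun _ _ => Nat.zero_le _) hi
      have hadj : i = a ∨ i = b ∨ i = c := by
        by_contra hc
        have : w i = 2 := by simp only [hw, if_neg hiv, if_neg hc]
        omega
      have hA : Δ.Adj v i := by rcases hadj with rfl | rfl | rfl <;> assumption
      refine Δ.down_closed hA.2 (fun j hj => ?_)
      by_contra hji
      simp only [Finset.mem_insert, Finset.mem_singleton, not_or] at hji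
      have h2 : ∑ l ∈ ({i, j} : Finset (Fin n)), w l ≤ ∑ l ∈ G, w l := by
        apply Finset.sum_le_sum_of_subset
        intro l hl
        simp only [Finset.mem_insert, Finset.mem_singleton] at hl
        rcases hl with rfl | rfl <;> assumption
      rw [Finset.sum_pair (Ne.symm hji.2)] at h2
      have h3 : 1 ≤ w i := by simp only [hw, if_neg hiv]; split_ifs <;> omega
      have h4 : 1 ≤ w j := by simp only [hw, if_neg hji.1]; split_ifs <;> omega
      omega
    · push Not at hex
      exact Δ.down_closed (hV v) (fun i hi => by simpa using hex i hi)
  · rw [hez, wt_add, wt_add, wt_add, wt_single, wt_single, wt_single, wt_single, hwv, hwa, hwb, hwc]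
    omega

end LCx

end

noncomputable section
open CategoryTheory Opposite Limits MvPolynomial
namespace LCx
variable {K : Type} [Field K] {n : ℕ}

lemma dim_F (F : Finset (Fin n)) : ringKrullDim (MvPolynomial F K) = (F.card : WithBot ℕ∞) := by
  rw [MvPolynomial.ringKrullDim_of_isNoetherianRing, ringKrullDim_eq_zero_of_field, zero_add]
  simp

lemma one_lt_dim (Δ : SimComplex n) (hedge : ∃ F ∈ Δ.faces, F.card = 2) (m : ℕ) (hm : 1 ≤ m) :
    1 < ringKrullDim (SS K n ⧸ (SRIdeal K Δ ^ m)) := by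
  classical
  obtain ⟨F, hF, hc⟩ := hedge
  let φ : SS K n →ₐ[K] MvPolynomial F K := aeval (fun i => if h : i ∈ F then X ⟨i, h⟩ else 0)
  have hsurj : Function.Surjective φ := by
    rw [← AlgHom.range_eq_top, eq_top_iff, ← MvPolynomial.adjoin_range_X, Algebra.adjoin_le_iff]
    rintro _ ⟨i, rfl⟩
    refine ⟨X i.1, ?_⟩
    simp [φ]
  have hker : ∀ p ∈ SRIdeal K Δ ^ m, φ.toRingHom p = 0 := by
    intro p hp
    have h1 := Ideal.pow_le_self (by omega) hp
    have h2 : SRIdeal K Δ ≤ RingHom.ker φ.toRingHom := by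
      rw [SRIdeal, Ideal.span_le]
      rintro _ ⟨G, hG, rfl⟩
      have : ∃ i ∈ G, i ∉ F := by
        by_contra hcon
        push Not at hcon
        exact hG (Δ.down_closed hF hcon)
      obtain ⟨i, hi, hiF⟩ := this
      change φ (faceMonomial K G) = 0
      rw [faceMonomial, map_prod]
      exact Finset.prod_eq_zero hi (by simp [φ, hiF])
    exact h2 h1
  have := ringKrullDim_le_of_surjective (Ideal.Quotient.lift (SRIdeal K Δ ^ m) φ.toRingHom hker)
    (Ideal.Quotient.lift_surjective_of_surjective _ _ hsurj)
  refine lt_of_lt_of_le ?_ this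
  rw [dim_F, hc]
  exact_mod_cast Nat.one_lt_two

lemma dim_le_of_quot {A : Type} [CommRing A] (N : ℕ)
    (h : ∀ Q : Ideal A, Q.IsPrime → ringKrullDim (A ⧸ Q) ≤ N) : ringKrullDim A ≤ N := by
  rw [ringKrullDim, Order.krullDim]
  refine iSup_le (fun l => ?_)
  have h1 := h l.head.asIdeal l.head.2
  rw [ringKrullDim_quotient] at h1
  let l' : LTSeries (PrimeSpectrum.zeroLocus (l.head.asIdeal : Set A)) :=
    { length := l.length
      toFun := fun i => ⟨l i, by
        have : l.head ≤ l i := l.head_le i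
        exact this⟩
      step := fun i => l.step i }
  exact (Order.LTSeries.length_le_krullDim l').trans h1

lemma dim_le_two (Δ : SimComplex n) (hgraph : ∀ F ∈ Δ.faces, F.card ≤ 2) (m : ℕ) :
    ringKrullDim (SS K n ⧸ (SRIdeal K Δ ^ m)) ≤ 2 := by
  classical
  refine dim_le_of_quot 2 (fun Q hQ => ?_)
  let π : SS K n →ₐ[K] ((SS K n ⧸ (SRIdeal K Δ ^ m)) ⧸ Q) :=
    (Ideal.Quotient.mkₐ K Q).comp (Ideal.Quotient.mkₐ K (SRIdeal K Δ ^ m))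
  have hπ : Function.Surjective π :=
    (Ideal.Quotient.mk_surjective).comp (Ideal.Quotient.mk_surjective)
  have hdom : IsDomain ((SS K n ⧸ (SRIdeal K Δ ^ m)) ⧸ Q) := Ideal.Quotient.isDomain Q
  let F : Finset (Fin n) := Finset.univ.filter (fun i => π (X i) ≠ 0)
  have hF : F ∈ Δ.faces := by
    by_contra hF
    have h1 := Ideal.pow_mem_pow (faceMon_mem (K := K) Δ hF) m
    have h2 : π (faceMonomial K F ^ m) = 0 := by
      change Ideal.Quotient.mk Q (Ideal.Quotient.mk _ (faceMonomial K F ^ m)) = 0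
      rw [Ideal.Quotient.eq_zero_iff_mem.2 h1, map_zero]
    rw [map_pow] at h2
    have h3 := eq_zero_of_pow_eq_zero h2
    rw [faceMonomial, map_prod, Finset.prod_eq_zero_iff] at h3
    obtain ⟨i, hi, h4⟩ := h3
    exact (Finset.mem_filter.1 hi).2 h4
  let φ : MvPolynomial F K →ₐ[K] ((SS K n ⧸ (SRIdeal K Δ ^ m)) ⧸ Q) := aeval (fun i => π (X i.1))
  have hφ : Function.Surjective φ := by
    have h1 : ∀ p : SS K n, π p ∈ φ.range := by
      intro p
      induction p using MvPolynomial.induction_on with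
      | C a => exact ⟨C a, by simp [φ]⟩
      | add p q hp hq => rw [map_add]; exact add_mem hp hq
      | mul_X p i hp =>
        rw [map_mul]
        refine mul_mem hp ?_
        by_cases hi : π (X i) = 0
        · rw [hi]; exact zero_mem _
        · exact ⟨X ⟨i, Finset.mem_filter.2 ⟨Finset.mem_univ _, hi⟩⟩, by simp [φ]⟩
    intro y
    obtain ⟨p, rfl⟩ := hπ y
    exact h1 p
  have := ringKrullDim_le_of_surjective φ.toRingHom hφ
  rw [dim_F] at this
  refine this.trans ?_
  exact_mod_cast hgraph F hF

end LCx

end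

noncomputable section
namespace LCx
variable {n : ℕ}

lemma adj_symm {Δ : SimComplex n} {u v : Fin n} (h : Δ.Adj u v) : Δ.Adj v u :=
  ⟨h.1.symm, by rw [Finset.pair_comm]; exact h.2⟩

lemma reach_symm {Δ : SimComplex n} {u v : Fin n} (h : Δ.Reach u v) : Δ.Reach v u := by
  induction h with
  | refl => exact Relation.ReflTransGen.refl
  | tail _ h2 ih => exact Relation.ReflTransGen.head (adj_symm h2) ih

lemma comp_edge {Δ : SimComplex n} {v j : Fin n} (h : Δ.Adj v j) :
    ({v, j} : Finset (Fin n)) ∈ (Δ.component v).faces ∧ ({v, j} : Finset (Fin n)).card = 2 := by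
  refine ⟨⟨h.2, ?_⟩, Finset.card_pair h.1⟩
  intro x hx
  simp only [Finset.coe_insert, Finset.coe_singleton, Set.mem_insert_iff, Set.mem_singleton_iff] at hx
  rcases hx with rfl | rfl
  · exact Relation.ReflTransGen.refl
  · exact Relation.ReflTransGen.single h

lemma pair_cases {v j x y : Fin n} (hvj : v ≠ j) (h : ({v, j} : Finset (Fin n)) = {x, y}) :
    (v = x ∧ j = y) ∨ (v = y ∧ j = x) := by
  have h1 : v ∈ ({x, y} : Finset (Fin n)) := by rw [← h]; simp
  have h2 : j ∈ ({x, y} : Finset (Fin n)) := by rw [← h]; simp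
  simp only [Finset.mem_insert, Finset.mem_singleton] at h1 h2
  rcases h1 with h1 | h1 <;> rcases h2 with h2 | h2
  · exact absurd (h1.trans h2.symm) hvj
  · exact Or.inl ⟨h1, h2⟩
  · exact Or.inr ⟨h1, h2⟩
  · exact absurd (h1.trans h2.symm) hvj

lemma deg_of_comp (Δ : SimComplex n) (hV : ∀ i : Fin n, ({i} : Finset (Fin n)) ∈ Δ.faces) (v : Fin n)
    (h : (Δ.component v).IsPathGraph ∨ (Δ.component v).IsCycleGraph) :
    ∃ p q, ∀ j, Δ.Adj v j → j = p ∨ j = q := by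
  have hv : v ∈ (Δ.component v).vertexSet := by
    refine ⟨hV v, ?_⟩
    simp only [Finset.coe_singleton, Set.singleton_subset_iff]
    exact Relation.ReflTransGen.refl
  rcases h with ⟨k, f, hf, hvs, he⟩ | ⟨k, f, hf, hvs, he⟩
  · rw [hvs] at hv
    obtain ⟨i, rfl⟩ := hv
    refine ⟨if h : i.1 + 1 < k + 2 then f ⟨i.1 + 1, h⟩ else f i, f ⟨i.1 - 1, by omega⟩, fun j hj => ?_⟩
    obtain ⟨l, hl⟩ := (he _).1 (comp_edge hj)
    rcases pair_cases hj.1 hl with ⟨h1, h2⟩ | ⟨h1, h2⟩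
    · left
      have := hf h1
      subst this
      rw [dif_pos (by simp; omega), h2]
      rfl
    · right
      have := hf h1
      subst this
      rw [h2]
      rfl
  · rw [hvs] at hv
    obtain ⟨i, rfl⟩ := hv
    refine ⟨f (i + 1), f (i - 1), fun j hj => ?_⟩
    obtain ⟨l, hl⟩ := (he _).1 (comp_edge hj)
    rcases pair_cases hj.1 hl with ⟨h1, h2⟩ | ⟨h1, h2⟩
    · left
      have := hf h1
      rw [h2, this]
    · right
      have := hf h1
      rw [h2, this, add_sub_cancel_right]

def Wk (Δ : SimComplex n) (v : Fin n) (k : ℕ) (f : ℕ → Fin n) : Prop :=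
  (∀ i j, i ≤ k → j ≤ k → f i = f j → i = j) ∧ (∀ i, i < k → Δ.Adj (f i) (f (i + 1))) ∧ Δ.Reach v (f 0)

lemma Wk_reach {Δ : SimComplex n} {v : Fin n} {k : ℕ} {f : ℕ → Fin n} (h : Wk Δ v k f) (i : ℕ) (hi : i ≤ k) :
    Δ.Reach v (f i) := by
  induction i with
  | zero => exact h.2.2
  | succ i ih => exact (ih (by omega)).tail (h.2.1 i (by omega))

lemma Wk_rev {Δ : SimComplex n} {v : Fin n} {k : ℕ} {f : ℕ → Fin n} (h : Wk Δ v k f) :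
    Wk Δ v k (fun i => f (k - i)) := by
  refine ⟨fun i j hi hj hij => ?_, fun i hi => ?_, ?_⟩
  · have := h.1 _ _ (Nat.sub_le k i) (Nat.sub_le k j) hij
    omega
  · have := h.2.1 (k - (i + 1)) (by omega)
    rw [show k - (i + 1) + 1 = k - i by omega] at this
    exact adj_symm this
  · exact Wk_reach h _ (Nat.sub_le _ _)

lemma Wk_cons {Δ : SimComplex n} {v : Fin n} {k : ℕ} {f : ℕ → Fin n} (h : Wk Δ v k f) {x : Fin n}
    (hx : Δ.Adj (f 0) x) (hr : ∀ j ≤ k, x ≠ f j) : ∃ g, Wk Δ v (k + 1) g := by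
  refine ⟨fun i => Nat.casesOn i x f, ?_, ?_, ?_⟩
  · rintro (_ | i) (_ | j) hi hj hij
    · rfl
    · exact absurd hij (hr j (by omega))
    · exact absurd hij.symm (hr i (by omega))
    · rw [h.1 i j (by omega) (by omega) hij]
  · rintro (_ | i) hi
    · exact adj_symm hx
    · exact h.2.1 i (by omega)
  · exact h.2.2.tail hx

lemma Wk_bound {Δ : SimComplex n} {v : Fin n} {k : ℕ} {f : ℕ → Fin n} (h : Wk Δ v k f) : k < n := by
  have := Fintype.card_le_of_injective (fun i : Fin (k + 1) => f i) (fun i j hij => by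
    ext; exact h.1 i j (by omega) (by omega) hij)
  simp at this
  omega

lemma end_nbr {Δ : SimComplex n} (hd : ∀ v a b c, Δ.Adj v a → Δ.Adj v b → Δ.Adj v c → a ≠ b → c = a ∨ c = b)
    {v : Fin n} {k : ℕ} {f : ℕ → Fin n} (h : Wk Δ v k f) (hmax : ∀ g, ¬ Wk Δ v (k + 1) g)
    {x : Fin n} (hx : Δ.Adj (f 0) x) : ∃ j ≤ k, x = f j ∧ (j = 1 ∨ j = k) := by
  have : ∃ j ≤ k, x = f j := by
    by_contra hc
    push Not at hc
    obtain ⟨g, hg⟩ := Wk_cons h hx hc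
    exact hmax g hg
  obtain ⟨j, hj, rfl⟩ := this
  refine ⟨j, hj, rfl, ?_⟩
  have hj0 : j ≠ 0 := by rintro rfl; exact hx.1 rfl
  by_contra hc
  have h1 := h.2.1 (j - 1) (by omega)
  rw [show j - 1 + 1 = j by omega] at h1
  have h2 := h.2.1 j (by omega)
  rcases hd _ _ _ _ (adj_symm h1) h2 (adj_symm hx) (fun hh => by
    have := h.1 _ _ (by omega) (by omega) hh; omega) with h3 | h3
  · have := h.1 _ _ (by omega) (by omega) h3; omega
  · have := h.1 _ _ (by omega) (by omega) h3; omega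

lemma nbr {Δ : SimComplex n} (hd : ∀ v a b c, Δ.Adj v a → Δ.Adj v b → Δ.Adj v c → a ≠ b → c = a ∨ c = b)
    {v : Fin n} {k : ℕ} {f : ℕ → Fin n} (h : Wk Δ v k f) (hmax : ∀ g, ¬ Wk Δ v (k + 1) g)
    {i : ℕ} (hi : i ≤ k) {x : Fin n} (hx : Δ.Adj (f i) x) :
    ∃ j ≤ k, x = f j ∧ (j + 1 = i ∨ j = i + 1 ∨ (i = 0 ∧ j = k) ∨ (i = k ∧ j = 0)) := by
  by_cases h0 : i = 0
  · subst h0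
    obtain ⟨j, hj, e, hh⟩ := end_nbr hd h hmax hx
    exact ⟨j, hj, e, by omega⟩
  by_cases h1 : i = k
  · subst h1
    obtain ⟨j, hj, e, hh⟩ := end_nbr hd (Wk_rev h) hmax (x := x) (by simpa using hx)
    exact ⟨i - j, by omega, e, by omega⟩
  · have e1 := h.2.1 (i - 1) (by omega)
    rw [show i - 1 + 1 = i by omega] at e1
    have e2 := h.2.1 i (by omega)
    rcases hd _ _ _ _ (adj_symm e1) e2 hx (fun hh => by
      have := h.1 _ _ (by omega) (by omega) hh; omega) with h3 | h3
    · exact ⟨i - 1, by omega, h3, by omega⟩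
    · exact ⟨i + 1, by omega, h3, by omega⟩

lemma comp_of_deg (Δ : SimComplex n) (hV : ∀ i : Fin n, ({i} : Finset (Fin n)) ∈ Δ.faces)
    (hiso : ∀ v : Fin n, ∃ w : Fin n, w ≠ v ∧ ({v, w} : Finset (Fin n)) ∈ Δ.faces)
    (hd : ∀ v a b c, Δ.Adj v a → Δ.Adj v b → Δ.Adj v c → a ≠ b → c = a ∨ c = b) (v : Fin n) :
    (Δ.component v).IsPathGraph ∨ (Δ.component v).IsCycleGraph := by
  classical
  obtain ⟨w, hwv, hw⟩ := hiso v
  have hvw : Δ.Adj v w := ⟨hwv.symm, hw⟩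
  have hw1 : ∃ f, Wk Δ v 1 f := by
    refine ⟨fun i => if i = 0 then v else w, ?_, ?_, ?_⟩
    · intro i j hi hj hij
      interval_cases i <;> interval_cases j <;> simp_all
    · intro i hi
      interval_cases i
      simpa using hvw
    · exact Relation.ReflTransGen.refl
  have hmx : ∃ k f, 1 ≤ k ∧ Wk Δ v k f ∧ ∀ g, ¬ Wk Δ v (k + 1) g := by
    let P : ℕ → Prop := fun k => ∃ f, Wk Δ v k f
    have hb : ∀ k, P k → k ≤ n := fun k ⟨f, hf⟩ => (Wk_bound hf).le
    obtain ⟨f, hf⟩ : P (Nat.findGreatest P n) := Nat.findGreatest_spec (hb 1 hw1) hw1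
    refine ⟨Nat.findGreatest P n, f, Nat.le_findGreatest (hb 1 hw1) hw1, hf, fun g hg => ?_⟩
    have : Nat.findGreatest P n + 1 ≤ Nat.findGreatest P n :=
      Nat.le_findGreatest (hb _ ⟨g, hg⟩) ⟨g, hg⟩
    omega
  obtain ⟨k, f, hk, hf, hmax⟩ := hmx
  have hcl : ∀ x y, Δ.Reach x y → (∃ i ≤ k, x = f i) → ∃ j ≤ k, y = f j := by
    intro x y hxy hx
    induction hxy with
    | refl => exact hx
    | tail _ h2 ih =>
      obtain ⟨i, hi, rfl⟩ := ih
      obtain ⟨j, hj, e, _⟩ := nbr hd hf hmax hi h2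
      exact ⟨j, hj, e⟩
  have hW : ∀ u, Δ.Reach v u ↔ ∃ j ≤ k, u = f j := by
    intro u
    constructor
    · intro hu
      obtain hv := hcl _ _ (reach_symm hf.2.2) ⟨0, by omega, rfl⟩
      exact hcl _ _ hu hv
    · rintro ⟨j, hj, rfl⟩
      exact Wk_reach hf j hj
  have hvs : ∀ u, u ∈ (Δ.component v).vertexSet ↔ ∃ j ≤ k, u = f j := by
    intro u
    rw [← hW]
    constructor
    · rintro ⟨_, h⟩
      exact h (by simp)
    · intro h
      exact ⟨hV u, by simpa using h⟩
  have hed : ∀ e : Finset (Fin n), (e ∈ (Δ.component v).faces ∧ e.card = 2) ↔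
      ∃ i j, i ≤ k ∧ j ≤ k ∧ e = {f i, f j} ∧ Δ.Adj (f i) (f j) := by
    intro e
    constructor
    · rintro ⟨⟨h1, h2⟩, h3⟩
      obtain ⟨a, b, hab, rfl⟩ := Finset.card_eq_two.1 h3
      obtain ⟨i, hi, rfl⟩ := (hW a).1 (h2 (by simp))
      obtain ⟨j, hj, rfl⟩ := (hW b).1 (h2 (by simp))
      exact ⟨i, j, hi, hj, rfl, hab, h1⟩
    · rintro ⟨i, j, hi, hj, rfl, hA⟩
      refine ⟨⟨hA.2, ?_⟩, Finset.card_pair hA.1⟩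
      intro x hx
      simp only [Finset.coe_insert, Finset.coe_singleton, Set.mem_insert_iff, Set.mem_singleton_iff] at hx
      rcases hx with rfl | rfl
      · exact Wk_reach hf i hi
      · exact Wk_reach hf j hj
  by_cases hcyc : 2 ≤ k ∧ Δ.Adj (f 0) (f k)
  · right
    obtain ⟨hk2, hA⟩ := hcyc
    obtain ⟨r, rfl⟩ := Nat.exists_eq_add_of_le' hk2
    have hval : ∀ i : Fin (r + 3), ((i + 1 : Fin (r + 3)) : ℕ) = if i.1 = r + 2 then 0 else i.1 + 1 := by
      intro i
      rw [Fin.val_add_one]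
      congr 1
      simp [Fin.ext_iff]
    refine ⟨r, fun i => f i, fun i j hij => ?_, ?_, fun e => ?_⟩
    · ext; exact hf.1 _ _ (by omega) (by omega) hij
    · ext u
      rw [hvs]
      constructor
      · rintro ⟨j, hj, rfl⟩; exact ⟨⟨j, by omega⟩, rfl⟩
      · rintro ⟨j, rfl⟩; exact ⟨j, by omega, rfl⟩
    · rw [hed]
      constructor
      · rintro ⟨i, j, hi, hj, rfl, hij⟩
        obtain ⟨j', hj', e, hh⟩ := nbr hd hf hmax hi hij
        have := hf.1 _ _ hj hj' e
        subst this
        rcases hh with rfl | rfl | ⟨rfl, rfl⟩ | ⟨rfl, rfl⟩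
        · refine ⟨⟨j, by omega⟩, ?_⟩
          beta_reduce
          rw [hval, if_neg (by simp; omega), Finset.pair_comm]
        · refine ⟨⟨i, by omega⟩, ?_⟩
          beta_reduce
          rw [hval, if_neg (by simp; omega)]
        · refine ⟨⟨r + 2, by omega⟩, ?_⟩
          beta_reduce
          rw [hval, if_pos (by simp), Finset.pair_comm]
        · refine ⟨⟨r + 2, by omega⟩, ?_⟩
          beta_reduce
          rw [hval, if_pos (by simp)]
      · rintro ⟨i, rfl⟩
        beta_reduce
        rw [hval]
        split_ifs with hh
        · exact ⟨i, 0, by omega, by omega, rfl, by rw [hh]; exact adj_symm hA⟩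
        · exact ⟨i, i + 1, by omega, by omega, rfl, hf.2.1 _ (by omega)⟩
  · left
    obtain ⟨r, rfl⟩ := Nat.exists_eq_add_of_le' hk
    refine ⟨r, fun i => f i, fun i j hij => ?_, ?_, fun e => ?_⟩
    · ext; exact hf.1 _ _ (by omega) (by omega) hij
    · ext u
      rw [hvs]
      constructor
      · rintro ⟨j, hj, rfl⟩; exact ⟨⟨j, by omega⟩, rfl⟩
      · rintro ⟨j, rfl⟩; exact ⟨j, by omega, rfl⟩
    · rw [hed]
      constructor
      · rintro ⟨i, j, hi, hj, rfl, hij⟩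
        obtain ⟨j', hj', e, hh⟩ := nbr hd hf hmax hi hij
        have := hf.1 _ _ hj hj' e
        subst this
        have key : j + 1 = i ∨ j = i + 1 := by
          rcases hh with hh | hh | ⟨h1, h2⟩ | ⟨h1, h2⟩
          · exact Or.inl hh
          · exact Or.inr hh
          · subst h1 h2
            have : ¬ 2 ≤ r + 1 := fun h => hcyc ⟨h, hij⟩
            omega
          · subst h1 h2
            have : ¬ 2 ≤ r + 1 := fun h => hcyc ⟨h, adj_symm hij⟩
            omega
        rcases key with hh | hh
        · refine ⟨⟨j, by omega⟩, ?_⟩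
          subst hh
          rw [Finset.pair_comm]
          rfl
        · refine ⟨⟨i, by omega⟩, ?_⟩
          subst hh
          rfl
      · rintro ⟨i, rfl⟩
        exact ⟨i, i + 1, by omega, by omega, rfl, hf.2.1 _ (by omega)⟩

end LCx

end

/-- **Theorem.** For a graph `Δ` (a 1-dimensional complex on `[n]` without isolated
vertices): all ordinary powers of `I_Δ` are generalized Cohen–Macaulay iff some `I_Δ^m`,
`m ≥ 3`, is generalized Cohen–Macaulay iff every connected component of `Δ` is a path or
a cycle. -/
theorem graph_ordinary_powers_genCM_iff_paths_and_cycles (K : Type) [Field K] {n : ℕ}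
    (Δ : SimComplex n)
    (hV : ∀ i : Fin n, ({i} : Finset (Fin n)) ∈ Δ.faces)
    (hgraph : ∀ F ∈ Δ.faces, F.card ≤ 2)
    (hedge : ∃ F ∈ Δ.faces, F.card = 2)
    (hiso : ∀ v : Fin n, ∃ w : Fin n, w ≠ v ∧ ({v, w} : Finset (Fin n)) ∈ Δ.faces) :
    List.TFAE
      [∀ m : ℕ, 1 ≤ m → IsGeneralizedCM K (SRIdeal K Δ ^ m),
       ∃ m : ℕ, 3 ≤ m ∧ IsGeneralizedCM K (SRIdeal K Δ ^ m),
       ∀ v ∈ Δ.vertexSet, (Δ.component v).IsPathGraph ∨ (Δ.component v).IsCycleGraph] := by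
  tfae_have 1 → 2 := fun h => ⟨3, le_rfl, h 3 (by omega)⟩
  tfae_have 2 → 3 := by
    rintro ⟨m, hm, h⟩ v _
    refine LCx.comp_of_deg Δ hV hiso (fun u a b c ha hb hc hab => ?_) v
    by_contra hcon
    rw [not_or] at hcon
    exact LCx.not_genCM Δ hV hgraph m (by omega) (LCx.one_lt_dim Δ hedge m (by omega)) u a b c
      ha hb hc hab (Ne.symm hcon.1) (Ne.symm hcon.2) h
  tfae_have 3 → 1 := by
    intro h m _
    refine LCx.genCM_of_deg Δ hgraph (fun v => ?_) m (LCx.dim_le_two Δ hgraph m)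
    obtain ⟨p, q, hpq⟩ := LCx.deg_of_comp Δ hV v (h v (hV v))
    obtain ⟨w, hwv, hw⟩ := hiso v
    have hvw : Δ.Adj v w := ⟨hwv.symm, hw⟩
    by_cases hp : Δ.Adj v p
    · by_cases hq : Δ.Adj v q
      · exact ⟨p, q, hp, hq, hpq⟩
      · refine ⟨p, p, hp, hp, fun j hj => ?_⟩
        rcases hpq j hj with rfl | rfl
        · exact Or.inl rfl
        · exact absurd hj hq
    · refine ⟨w, w, hvw, hvw, fun j hj => ?_⟩
      have h1 : j = q := (hpq j hj).resolve_left (fun e => hp (e ▸ hj))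
      have h2 : w = q := (hpq w hvw).resolve_left (fun e => hp (e ▸ hvw))
      exact Or.inl (h1.trans h2.symm)
  tfae_finish
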